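/- Let K be a field and let G be a finite connected simple graph satisfying the odd-cycle condition. Then the projective dimension of the edge ring K[G] as a module over the polynomial ring K[E(G)] equals |E(G)| − |V(G)| + 1 if G is bipartite, and equals |E(G)| − |V(G)| if G is not bipartite. -/

import Mathlib

open CategoryTheory MvPolynomial Finset
open scoped Classical

noncomputable section

namespace Paper

/-- The monomial `x_u * x_v` associated to an unordered pair `{u, v}` of vertices. -/
def edgeMon (K : Type*) [CommRing K] {V : Type*} (e : Sym2 V) : MvPolynomial V K :=
  Sym2.lift ⟨fun u v => X u * X v, fun u v => mul_comm _ _⟩ e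

/-- The `K`-algebra map `K[E(G)] → K[V(G)]` sending the variable of an edge `{u,v}` to
`x_u * x_v`. -/
def edgeHom (K : Type*) [CommRing K] {V : Type*} (G : SimpleGraph V) :
    MvPolynomial G.edgeSet K →ₐ[K] MvPolynomial V K :=
  aeval (fun e => edgeMon K (e : Sym2 V))

/-- The toric ideal of a simple graph. -/
def toricIdeal (K : Type*) [CommRing K] {V : Type*} (G : SimpleGraph V) :
    Ideal (MvPolynomial G.edgeSet K) :=
  RingHom.ker (edgeHom K G).toRingHom

/-- The edge ring `K[G] = K[E(G)]/I_G`. -/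
abbrev edgeRing (K : Type*) [CommRing K] {V : Type*} (G : SimpleGraph V) :=
  MvPolynomial G.edgeSet K ⧸ toricIdeal K G

open CategoryTheory.Limits in
/-- The projective dimension of a module, as an element of `ℕ∞`:  the least `n` such that `M`
admits a projective resolution vanishing in homological degrees `> n` (or `⊤` if there is
no such finite resolution). -/
def projDim (R : Type*) [CommRing R] (M : ModuleCat R) : ℕ∞ :=
  sInf {n : ℕ∞ | ∃ m : ℕ, (m : ℕ∞) = n ∧
    ∃ P : ProjectiveResolution M, ∀ i : ℕ, m < i → IsZero (P.complex.X i)}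

/-- The 0-1 vector `ε_u + ε_v` attached to an unordered pair `{u,v}` with `u ≠ v`. -/
def edgeVec {V : Type*} (e : Sym2 V) : V → ℝ :=
  fun v => if v ∈ e then 1 else 0

/-- The edge cone of a finite simple graph: all nonnegative real combinations of the vectors
`v_e = ε_u + ε_v`, for `e = {u,v}` an edge of `G`. -/
def edgeCone {V : Type*} [Fintype V] (G : SimpleGraph V) : Set (V → ℝ) :=
  {x | ∃ a : Sym2 V → ℝ, (∀ e, 0 ≤ a e) ∧ (∀ e, e ∉ G.edgeSet → a e = 0) ∧
    x = ∑ e : Sym2 V, a e • edgeVec e}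

/-- A vector has integer coordinates. -/
def IsIntegralVec {V : Type*} (x : V → ℝ) : Prop := ∀ v, ∃ n : ℤ, x v = n

/-- A minimal vector of `relint(ℝ₊(G)) ∩ ℤ^{V(G)}`. -/
def IsMinimalVec {V : Type*} [Fintype V] (G : SimpleGraph V) (x : V → ℝ) : Prop :=
  x ∈ intrinsicInterior ℝ (edgeCone G) ∧ IsIntegralVec x ∧
    ¬ ∃ y z : V → ℝ, (y ∈ intrinsicInterior ℝ (edgeCone G) ∧ IsIntegralVec y) ∧
      (z ∈ edgeCone G ∧ IsIntegralVec z ∧ z ≠ 0) ∧ x = y + z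

/-! ### Multi-path graphs.  `c i` is the number of interior vertices of the `i`-th path,
so the `i`-th path has length `c i + 1`. -/

/-- Vertices of the multi-path graph: `Sum.inl 0 = v1`, `Sum.inl 1 = v2`, and
`Sum.inr ⟨i, j⟩ = u_{i,j+1}`, the `(j+1)`-st interior vertex of the `i`-th path. -/
abbrev MPV {m : ℕ} (c : Fin m → ℕ) : Type := Fin 2 ⊕ (Σ i : Fin m, Fin (c i))

def mpRel {m : ℕ} (c : Fin m → ℕ) : MPV c → MPV c → Prop
  | Sum.inl a, Sum.inr ⟨i, j⟩ => (a = 0 ∧ (j : ℕ) = 0) ∨ (a = 1 ∧ (j : ℕ) + 1 = c i)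
  | Sum.inr ⟨i, j⟩, Sum.inr ⟨i', j'⟩ => (i : ℕ) = i' ∧ (j' : ℕ) = (j : ℕ) + 1
  | _, _ => False

/-- The multi-path graph with `m` paths, the `i`-th of which has `c i` interior vertices
(hence length `c i + 1`), all starting at `v1 = Sum.inl 0` and ending at `v2 = Sum.inl 1`. -/
def multiPath {m : ℕ} (c : Fin m → ℕ) : SimpleGraph (MPV c) :=
  SimpleGraph.fromRel (mpRel c)

/-! ### The two-ear graph `G_m` and the one-ear graph `P_m`. -/

/-- Vertices of the two-ear graph:  `Sum.inl 0 = v1`, `Sum.inl 1 = v2`, `Sum.inl 2 = x1`,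
`Sum.inl 3 = x2`, `Sum.inl 4 = y1`, `Sum.inl 5 = y2`, and `Sum.inr i = u_{i+1}`. -/
abbrev TEV (m : ℕ) : Type := Fin 6 ⊕ Fin (m - 1)

def teRel (m : ℕ) : TEV m → TEV m → Prop
  | Sum.inl a, Sum.inl b =>
      (a = 0 ∧ b = 2) ∨ (a = 0 ∧ b = 3) ∨ (a = 2 ∧ b = 3) ∨ (a = 1 ∧ b = 4) ∨
      (a = 1 ∧ b = 5) ∨ (a = 4 ∧ b = 5) ∨ (a = 2 ∧ b = 4)
  | Sum.inl a, Sum.inr _ => a = 0 ∨ a = 1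
  | _, _ => False

/-- The two-ear graph `𝐆_m`. -/
def twoEar (m : ℕ) : SimpleGraph (TEV m) := SimpleGraph.fromRel (teRel m)

/-- The one-ear graph `𝐏_m`, the induced subgraph of `𝐆_m` on the complement of `x2`. -/
def oneEar (m : ℕ) : SimpleGraph ({v : TEV m | v ≠ Sum.inl 3} : Set (TEV m)) :=
  (twoEar m).induce {v : TEV m | v ≠ Sum.inl 3}

/-! ### Cycles, the odd-cycle condition, and compact graphs. -/

/-- The odd-cycle condition: any two vertex-disjoint odd cycles are joined by an edge. -/
def OddCycleCondition {V : Type*} (G : SimpleGraph V) : Prop :=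
  ∀ (a b : V) (c₁ : G.Walk a a) (c₂ : G.Walk b b), c₁.IsCycle → c₂.IsCycle →
    Odd c₁.length → Odd c₂.length →
    (∀ x, x ∈ c₁.support → x ∉ c₂.support) →
    ∃ x ∈ c₁.support, ∃ y ∈ c₂.support, G.Adj x y

/-- `G` has no even cycle. -/
def HasNoEvenCycle {V : Type*} (G : SimpleGraph V) : Prop :=
  ∀ (a : V) (c : G.Walk a a), c.IsCycle → ¬ Even c.length

/-- A compact graph: connected, all degrees at least `2`, no even cycle, and the
odd-cycle condition holds. -/
def IsCompactGraph {V : Type*} (G : SimpleGraph V) : Prop :=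
  G.Connected ∧ (∀ v : V, 2 ≤ (G.neighborSet v).ncard) ∧ HasNoEvenCycle G ∧ OddCycleCondition G

/-- The number `t(G)` of minimal (= induced) cycles of `G`, counted via their vertex sets. -/
def cycleCount {V : Type*} (G : SimpleGraph V) : ℕ :=
  Set.ncard {S : Set V | ∃ (a : V) (c : G.Walk a a), c.IsCycle ∧
    (∀ x y, x ∈ c.support → y ∈ c.support → G.Adj x y → s(x, y) ∈ c.edges) ∧
    S = {x | x ∈ c.support}}

universe u v

section PartA
open CategoryTheory.Limits

universe w v₁ u₁
variable {C : Type u₁} [Category.{v₁} C] [Abelian C]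

theorem hasPD_of_resolution {M : C} {m : ℕ} (P : ProjectiveResolution M)
    (hP : ∀ i, m < i → IsZero (P.complex.X i)) : HasProjectiveDimensionLT M (m + 1) := by
  let _ := HasExt.standard C
  refine HasProjectiveDimensionLT.mk (fun i hi Y e => ?_)
  obtain ⟨f, hf, rfl⟩ := P.extMk_surjective e (i + 1) rfl
  have : f = 0 := (hP i (by omega)).eq_of_src _ _
  subst this
  exact P.extMk_zero _ _

/-- splice a resolution of the first term of a short exact sequence -/
theorem exists_splice (S : ShortComplex C) (hS : S.ShortExact) [Projective S.X₂]
    (Q : ProjectiveResolution S.X₁) (m : ℕ)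
    (hQ : ∀ i, m < i → IsZero (Q.complex.X i)) :
    ∃ P : ProjectiveResolution S.X₃, ∀ i, m + 1 < i → IsZero (P.complex.X i) := by
  have hmono := hS.mono_f
  have hepi := hS.epi_g
  let p0 : Q.complex.X 0 ⟶ S.X₁ := Q.π.f 0
  have hp0 : Epi p0 := inferInstanceAs (Epi (Q.π.f 0))
  have w0 : Q.complex.d 1 0 ≫ p0 = 0 := Q.complex_d_comp_π_f_zero
  have w : Q.complex.d 1 0 ≫ (p0 ≫ S.f) = 0 := by rw [← Category.assoc, w0, zero_comp]
  have hex0 : (ShortComplex.mk _ _ w0).Exact := Q.exact₀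
  let D := ChainComplex.augment Q.complex (p0 ≫ S.f) w
  let g0 : D.X 0 ⟶ S.X₃ := S.g
  have wπ : D.d 1 0 ≫ g0 = 0 := by
    show (p0 ≫ S.f) ≫ S.g = 0
    rw [Category.assoc, S.zero, comp_zero]
  refine ⟨{ complex := D
            projective := ?_
            π := (ChainComplex.toSingle₀Equiv _ _).symm ⟨g0, wπ⟩
            quasiIso := ?_ }, ?_⟩
  · intro n
    cases n with
    | zero => exact inferInstanceAs (Projective S.X₂)
    | succ n => exact inferInstanceAs (Projective (Q.complex.X n))
  · refine ⟨fun n => ?_⟩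
    rcases n with _ | n
    · rw [ChainComplex.quasiIsoAt₀_iff, ShortComplex.quasiIso_iff_of_zeros']
      · have h1 : (ShortComplex.mk (p0 ≫ S.f) S.g wπ).Exact := by
          let α : ShortComplex.mk (p0 ≫ S.f) S.g wπ ⟶ S :=
            { τ₁ := p0, τ₂ := 𝟙 _, τ₃ := 𝟙 _ }
          have : Epi α.τ₁ := hp0
          have : IsIso α.τ₂ := inferInstanceAs (IsIso (𝟙 _))
          have : Mono α.τ₃ := inferInstanceAs (Mono (𝟙 _))
          rw [ShortComplex.exact_iff_of_epi_of_isIso_of_mono α]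
          exact hS.exact
        have hπ : ((ChainComplex.toSingle₀Equiv D S.X₃).symm ⟨g0, wπ⟩).f 0 = g0 :=
          ChainComplex.toSingle₀Equiv_symm_apply_f_zero (C := D) g0 wπ
        refine (ShortComplex.exact_and_epi_g_iff_of_iso ?_).2 ⟨h1, hepi⟩
        exact ShortComplex.isoMk (Iso.refl _) (Iso.refl _) (Iso.refl _)
          ((Category.id_comp _).trans (Category.comp_id _).symm)
          (by
            refine (Category.id_comp _).trans ?_
            exact hπ.symm.trans (Category.comp_id _).symm)
      all_goals rfl
    · rw [quasiIsoAt_iff_exactAt']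
      · rw [HomologicalComplex.exactAt_iff' _ (n + 2) (n + 1) n (by simp) (by simp)]
        rcases n with _ | n
        · let α : ShortComplex.mk _ _ w0 ⟶ ShortComplex.mk _ _ w :=
            { τ₁ := 𝟙 _, τ₂ := 𝟙 _, τ₃ := S.f }
          have : Epi α.τ₁ := inferInstanceAs (Epi (𝟙 _))
          have : IsIso α.τ₂ := inferInstanceAs (IsIso (𝟙 _))
          have : Mono α.τ₃ := hmono
          exact (ShortComplex.exact_iff_of_epi_of_isIso_of_mono α).1 hex0
        · exact Q.exact_succ n
      · apply ChainComplex.exactAt_succ_single_obj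
  · intro i hi
    cases i with
    | zero => omega
    | succ i => exact hQ i (by omega)

theorem exists_resolution_of_hasPD [EnoughProjectives C] (m : ℕ) : ∀ (M : C),
    HasProjectiveDimensionLT M (m + 1) →
    ∃ P : ProjectiveResolution M, ∀ i, m < i → IsZero (P.complex.X i) := by
  induction m with
  | zero =>
    intro M hM
    have : Projective M := projective_iff_hasProjectiveDimensionLT_one.2 hM
    refine ⟨ProjectiveResolution.self M, fun i hi => ?_⟩
    exact HomologicalComplex.isZero_single_obj_X _ _ _ _ (by omega)
  | succ m ih =>
    intro M hM
    let S : ShortComplex C := ShortComplex.mk (kernel.ι (Projective.π M)) (Projective.π M) (by simp)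
    have hS : S.ShortExact :=
      { exact := ShortComplex.exact_of_f_is_kernel _ (kernelIsKernel _)
        mono_f := inferInstanceAs (Mono (kernel.ι _))
        epi_g := inferInstanceAs (Epi (Projective.π M)) }
    have : Projective S.X₂ := inferInstanceAs (Projective (Projective.over M))
    have h1 : HasProjectiveDimensionLT S.X₁ (m + 1) :=
      (hS.hasProjectiveDimensionLT_X₃_iff m inferInstance).1 hM
    obtain ⟨Q, hQ⟩ := ih S.X₁ h1
    exact exists_splice S hS Q m hQ

end PartA

/-- Computing `projDim` from the vanishing of `Ext`. -/
theorem projDim_eq_of {R : Type u} [CommRing R] (M : ModuleCat.{u} R) (c : ℕ)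
    (h1 : HasProjectiveDimensionLT M (c + 1)) (h2 : ¬ HasProjectiveDimensionLT M c) :
    projDim R M = c := by
  apply le_antisymm
  · exact sInf_le ⟨c, rfl, exists_resolution_of_hasPD c M h1⟩
  · refine le_sInf ?_
    rintro n ⟨m, rfl, P, hP⟩
    by_contra hlt
    have hlt' : m < c := by exact_mod_cast not_le.1 hlt
    have := hasPD_of_resolution P hP
    exact h2 (hasProjectiveDimensionLT_of_ge M (m + 1) c (by omega))

section PartB
open CategoryTheory.Limits CategoryTheory.Abelian

variable {R : Type u} [CommRing R]

/-- `g` induces zero on `Ext^q(-, Y)` for all `q > p` and all `Y`. -/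
def ExtNull (p : ℕ) {M N : ModuleCat.{u} R} (g : M ⟶ N) : Prop :=
  ∀ (q : ℕ), p < q → ∀ (Y : ModuleCat.{u} R) (e : Ext.{u} N Y q),
    (Ext.mk₀ g).comp e (zero_add q) = 0

theorem ExtNull.precomp {p : ℕ} {L M N : ModuleCat.{u} R} {g : M ⟶ N} (hg : ExtNull p g)
    (h : L ⟶ M) : ExtNull p (h ≫ g) := by
  intro q hq Y e
  rw [← Ext.mk₀_comp_mk₀_assoc, hg q hq Y e, Ext.comp_zero]

theorem ExtNull.postcomp {p : ℕ} {L M N : ModuleCat.{u} R} {g : M ⟶ N} (hg : ExtNull p g)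
    (h : N ⟶ L) : ExtNull p (g ≫ h) := by
  intro q hq Y e
  rw [← Ext.mk₀_comp_mk₀_assoc, hg q hq Y]

theorem ExtNull.mono {p p' : ℕ} (hp : p ≤ p') {M N : ModuleCat.{u} R} {g : M ⟶ N}
    (hg : ExtNull p g) : ExtNull p' g := fun q hq => hg q (by omega)

theorem ExtNull.of_projective {M N : ModuleCat.{u} R} [Projective N] (g : M ⟶ N) :
    ExtNull 0 g := by
  intro q hq Y e
  have : e = 0 := e.eq_zero_of_hasProjectiveDimensionLT 1 hq
  rw [this, Ext.comp_zero]

theorem ExtNull.hasPD {p : ℕ} {M : ModuleCat.{u} R} (h : ExtNull p (𝟙 M)) :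
    HasProjectiveDimensionLT M (p + 1) := by
  rw [hasProjectiveDimensionLT_iff.{u}]
  intro i hi Y e
  have := h i hi Y e
  rwa [Ext.mk₀_id_comp] at this

theorem ExtNull.of_ses {p : ℕ} {Z : ShortComplex (ModuleCat.{u} R)} (hZ : Z.ShortExact)
    (a : Z ⟶ Z) (h1 : ExtNull p a.τ₁) (h2 : ExtNull p a.τ₂) : ExtNull (p + 1) (a.τ₃ ≫ a.τ₃) := by
  intro q hq Y e
  rw [← Ext.mk₀_comp_mk₀_assoc]
  obtain ⟨r, rfl⟩ : ∃ r, q = 1 + r := ⟨q - 1, by omega⟩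
  have h3 : (Ext.mk₀ Z.g).comp ((Ext.mk₀ a.τ₃).comp e (zero_add _)) (zero_add _) = 0 := by
    rw [Ext.mk₀_comp_mk₀_assoc, ← a.comm₂₃, ← Ext.mk₀_comp_mk₀_assoc]
    exact h2 _ (by omega) _ _
  obtain ⟨e', he'⟩ := Ext.contravariant_sequence_exact₃ hZ Y _ h3 (n₀ := r) rfl
  rw [← he', ← Ext.comp_assoc (a₁₂ := 1) _ _ _ (by omega) (by omega) (by omega),
    ← ShortComplex.ShortExact.extClass_naturality hZ hZ a,
    Ext.comp_assoc (a₂₃ := r) _ _ _ (by omega) (by omega) (by omega),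
    h1 r (by omega), Ext.comp_zero]

/-- lower bound step -/
theorem ext_ne_zero_step {n : ℕ} {Z : ShortComplex (ModuleCat.{u} R)} (hZ : Z.ShortExact)
    (L : ModuleCat.{u} R) (f x : R) (e12 : Z.X₁ = Z.X₂)
    (hf : Z.f = f • eqToHom e12) (hfL : f • 𝟙 L = 0)
    (T : ModuleCat.{u} R) (s : T ⟶ Z.X₃) (t : Z.X₃ ⟶ T) (hst : t ≫ s = x • 𝟙 Z.X₃)
    (y : L ⟶ L) (hxL : (x • 𝟙 L) ≫ y = 𝟙 L)
    (hn : ∃ e : Ext.{u} Z.X₁ L n, e ≠ 0) : ∃ e : Ext.{u} T L (n + 1), e ≠ 0 := by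
  obtain ⟨e, he⟩ := hn
  have key : ∀ (X : ModuleCat.{u} R) (m : ℕ) (r : R) (ε : Ext.{u} X L m),
      (Ext.mk₀ (r • 𝟙 X)).comp ε (zero_add m) = ε.comp (Ext.mk₀ (r • 𝟙 L)) (add_zero m) := by
    intro X m r ε
    rw [← Ext.smul_eq_comp_mk₀, Ext.mk₀_smul, Ext.smul_comp, Ext.mk₀_id_comp]
  refine ⟨(Ext.mk₀ s).comp (hZ.extClass.comp e (add_comm 1 n)) (zero_add _), fun h0 => ?_⟩
  have h1 : hZ.extClass.comp e (add_comm 1 n) = 0 := by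
    have h2 := congrArg (fun z => (Ext.mk₀ t).comp z (zero_add _)) h0
    simp only [Ext.mk₀_comp_mk₀_assoc, hst, Ext.comp_zero, key] at h2
    have h3 := congrArg (fun z => z.comp (Ext.mk₀ y) (add_zero _)) h2
    simp only [Ext.comp_assoc_of_third_deg_zero, Ext.mk₀_comp_mk₀, hxL, Ext.zero_comp,
      Ext.comp_mk₀_id] at h3
    exact h3
  obtain ⟨e', he'⟩ := Ext.contravariant_sequence_exact₁ hZ L e _ h1
  apply he
  rw [← he', hf, Ext.mk₀_smul, Ext.smul_comp, ← Ext.comp_smul,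
    Ext.smul_eq_comp_mk₀, hfL, Ext.mk₀_zero, Ext.comp_zero, Ext.comp_zero]

end PartB

section PartC
open CategoryTheory.Limits CategoryTheory.Abelian

variable {R : Type u} [CommRing R]

/-- `I` is obtained from `0` by `n` steps, each of which adds a nonzerodivisor and then passes
to a larger ideal which is the same up to `x`-power torsion. -/
inductive RegChain (x : R) : ℕ → Ideal R → Prop
  | zero : RegChain x 0 ⊥
  | succ {n : ℕ} {I J : Ideal R} (f : R) (k : ℕ) (h : RegChain x n I)
      (hreg : ∀ z, f * z ∈ I → z ∈ I) (hf : f ∈ J) (hIJ : I ≤ J)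
      (hx : ∀ z ∈ J, x ^ k * z ∈ I ⊔ Ideal.span {f}) : RegChain x (n + 1) J

/-- the short complex given by multiplication by f on R mod I, with cokernel R mod (I, f) -/
def quotSC (I : Ideal R) (f : R) : ShortComplex (ModuleCat.{u} R) where
  X₁ := ModuleCat.of R (R ⧸ I)
  X₂ := ModuleCat.of R (R ⧸ I)
  X₃ := ModuleCat.of R (R ⧸ (I ⊔ Ideal.span {f}))
  f := f • 𝟙 _
  g := ModuleCat.ofHom (Submodule.factor le_sup_left)
  zero := by
    apply ModuleCat.hom_ext; apply LinearMap.ext; intro z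
    obtain ⟨z, rfl⟩ := Submodule.Quotient.mk_surjective _ z
    show Submodule.factor le_sup_left (f • (Submodule.Quotient.mk z : R ⧸ I)) = (0 : R ⧸ (I ⊔ Ideal.span {f}))
    rw [← Submodule.Quotient.mk_smul]
    refine (Submodule.Quotient.mk_eq_zero _).2 ?_
    exact Ideal.mul_mem_right _ _ (Ideal.mem_sup_right (Ideal.mem_span_singleton_self f))

theorem quotSC_shortExact (I : Ideal R) (f : R) (hreg : ∀ z, f * z ∈ I → z ∈ I) :
    (quotSC I f).ShortExact := by
  refine ShortComplex.ShortExact.mk' ?_ ?_ ?_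
  · rw [ShortComplex.moduleCat_exact_iff]
    intro z hz
    obtain ⟨z, rfl⟩ := Submodule.Quotient.mk_surjective _ z
    have hz' : z ∈ I ⊔ Ideal.span {f} := (Submodule.Quotient.mk_eq_zero _).1 hz
    obtain ⟨a, ha, b, hb, rfl⟩ := Submodule.mem_sup.1 hz'
    obtain ⟨c, rfl⟩ := Ideal.mem_span_singleton.1 hb
    refine ⟨Submodule.Quotient.mk c, ?_⟩
    show f • (Submodule.Quotient.mk c : R ⧸ I) = (Submodule.Quotient.mk _ : R ⧸ I)
    rw [← Submodule.Quotient.mk_smul]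
    refine (Submodule.Quotient.eq _).2 ?_
    have : f • c - (a + f * c) = -a := by simp
    rw [this]
    exact I.neg_mem ha
  · rw [ModuleCat.mono_iff_injective]
    refine (injective_iff_map_eq_zero _).2 ?_
    intro z hz
    obtain ⟨z, rfl⟩ := Submodule.Quotient.mk_surjective _ z
    change f • (Submodule.Quotient.mk z : R ⧸ I) = (0 : R ⧸ I) at hz
    rw [← Submodule.Quotient.mk_smul] at hz
    exact (Submodule.Quotient.mk_eq_zero _).2 (hreg z ((Submodule.Quotient.mk_eq_zero _).1 hz))
  · rw [ModuleCat.epi_iff_surjective]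
    exact Submodule.factor_surjective (le_sup_left : I ≤ I ⊔ Ideal.span {f})

/-- multiplication by `a` as an endomorphism of `quotSC` -/
def quotSCMul (I : Ideal R) (f a : R) : quotSC I f ⟶ quotSC I f where
  τ₁ := a • 𝟙 _
  τ₂ := a • 𝟙 _
  τ₃ := a • 𝟙 _

theorem quot_maps (I J : Ideal R) (a : R) (hIJ : I ≤ J) (ha : ∀ z ∈ J, a * z ∈ I) :
    ∃ (s : ModuleCat.of R (R ⧸ J) ⟶ ModuleCat.of R (R ⧸ I))
      (t : ModuleCat.of R (R ⧸ I) ⟶ ModuleCat.of R (R ⧸ J)),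
      s ≫ t = a • 𝟙 _ ∧ t ≫ s = a • 𝟙 _ := by
  have h : J ≤ Submodule.comap (LinearMap.lsmul R R a) I := fun z hz => ha z hz
  refine ⟨ModuleCat.ofHom (Submodule.mapQ J I (LinearMap.lsmul R R a) h),
    ModuleCat.ofHom (Submodule.factor hIJ), ?_, ?_⟩
  · apply ModuleCat.hom_ext; apply LinearMap.ext; intro z
    obtain ⟨z, rfl⟩ := Submodule.Quotient.mk_surjective _ z
    rfl
  · apply ModuleCat.hom_ext; apply LinearMap.ext; intro z
    obtain ⟨z, rfl⟩ := Submodule.Quotient.mk_surjective _ z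
    rfl

theorem RegChain.upper {x : R} {n : ℕ} {I : Ideal R} (h : RegChain x n I) :
    ∃ N : ℕ, ∀ Φ : R →+* R,
      Projective ((ModuleCat.restrictScalars.{u} Φ).obj (ModuleCat.of R R)) →
      ExtNull n ((ModuleCat.restrictScalars.{u} Φ).map (x ^ N • 𝟙 (ModuleCat.of R (R ⧸ I)))) := by
  induction h with
  | zero =>
    refine ⟨0, fun Φ hΦ => ?_⟩
    have e : ModuleCat.of R R ≅ ModuleCat.of R (R ⧸ (⊥ : Ideal R)) :=
      (Submodule.quotEquivOfEqBot _ rfl).symm.toModuleIso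
    have : Projective ((ModuleCat.restrictScalars.{u} Φ).obj (ModuleCat.of R (R ⧸ (⊥ : Ideal R)))) :=
      Projective.of_iso ((ModuleCat.restrictScalars.{u} Φ).mapIso e) hΦ
    exact ExtNull.of_projective _
  | @succ n I J f k h hreg hf hIJ hx ih =>
    obtain ⟨N, hN⟩ := ih
    refine ⟨k + N + N, fun Φ hΦ => ?_⟩
    have hle : I ⊔ Ideal.span {f} ≤ J := sup_le hIJ ((Ideal.span_singleton_le_iff_mem _).2 hf)
    obtain ⟨s, t, hst, hts⟩ := quot_maps _ _ _ hle hx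
    have hZ := (quotSC_shortExact I f hreg).map_of_exact (ModuleCat.restrictScalars.{u} Φ)
    have h3 := ExtNull.of_ses (p := n) hZ
      ((ModuleCat.restrictScalars.{u} Φ).mapShortComplex.map (quotSCMul I f (x ^ N)))
      (hN Φ hΦ) (hN Φ hΦ)
    have h4 := (h3.precomp ((ModuleCat.restrictScalars.{u} Φ).map s)).postcomp
      ((ModuleCat.restrictScalars.{u} Φ).map t)
    have h5 : x ^ (k + N + N) • 𝟙 (ModuleCat.of R (R ⧸ J)) =
        (s ≫ ((x ^ N • 𝟙 _) ≫ (x ^ N • 𝟙 _))) ≫ t := by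
      simp only [Linear.smul_comp, Linear.comp_smul, Category.comp_id, hst, smul_smul]
      congr 1
      ring
    rw [h5]
    simp only [Functor.map_comp]
    exact h4

theorem RegChain.lower {x : R} {n : ℕ} {I : Ideal R} (h : RegChain x n I)
    (L : ModuleCat.{u} R) [Nontrivial L] (y : L ⟶ L) (hy : (x • 𝟙 L) ≫ y = 𝟙 L)
    (hI : ∀ z ∈ I, z • 𝟙 L = 0) :
    ∃ e : Ext.{u} (ModuleCat.of R (R ⧸ I)) L n, e ≠ 0 := by
  have hyk : ∀ k : ℕ, ∃ y' : L ⟶ L, (x ^ k • 𝟙 L) ≫ y' = 𝟙 L := by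
    intro k
    induction k with
    | zero => exact ⟨𝟙 L, by simp⟩
    | succ k ih =>
      obtain ⟨y', hy'⟩ := ih
      refine ⟨y ≫ y', ?_⟩
      have : x ^ (k + 1) • 𝟙 L = (x ^ k • 𝟙 L) ≫ (x • 𝟙 L) := by
        simp [smul_smul, pow_succ, mul_comm]
      rw [this, Category.assoc, ← Category.assoc (x • 𝟙 L), hy, Category.id_comp, hy']
  induction h with
  | zero =>
    obtain ⟨l, hl⟩ := exists_ne (0 : L)
    let g : ModuleCat.of R R ⟶ L := ModuleCat.ofHom (LinearMap.toSpanSingleton R L l)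
    have hg : g ≠ 0 := by
      intro h0
      apply hl
      have := congrArg (fun φ => φ.hom (1 : R)) h0
      simpa [g] using this
    let e : ModuleCat.of R R ≅ ModuleCat.of R (R ⧸ (⊥ : Ideal R)) :=
      (Submodule.quotEquivOfEqBot _ rfl).symm.toModuleIso
    refine ⟨Ext.mk₀ (e.inv ≫ g), fun h0 => hg ?_⟩
    have h1 : e.inv ≫ g = 0 := by
      apply (Ext.mk₀_bijective _ _).1
      rw [h0, Ext.mk₀_zero]
    rw [← cancel_epi e.inv, h1, comp_zero]
  | @succ n I J f k h hreg hf hIJ hx ih =>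
    have hle : I ⊔ Ideal.span {f} ≤ J := sup_le hIJ ((Ideal.span_singleton_le_iff_mem _).2 hf)
    obtain ⟨s, t, hst, hts⟩ := quot_maps _ _ _ hle hx
    obtain ⟨y', hy'⟩ := hyk k
    exact ext_ne_zero_step (quotSC_shortExact I f hreg) L f (x ^ k) rfl rfl (hI f hf) _ s t hts
      y' hy' (ih (fun z hz => hI z (hIJ hz)))

end PartC

section PartD

variable {E : Type*} {K : Type*} [Field K]

/-- The monomial map attached to an additive map. -/
def binHom (K : Type*) [Field K] {E A : Type*} [AddCommMonoid A] (π : (E →₀ ℕ) →+ A) :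
    MvPolynomial E K →ₐ[K] AddMonoidAlgebra K A :=
  aeval (fun e => AddMonoidAlgebra.single (π (Finsupp.single e 1)) 1)

theorem binHom_monomial {A : Type*} [AddCommMonoid A] (π : (E →₀ ℕ) →+ A) (p : E →₀ ℕ) (c : K) :
    binHom K π (monomial p c) = AddMonoidAlgebra.single (π p) c := by
  have h : ∀ p : E →₀ ℕ, binHom K π (monomial p 1) = AddMonoidAlgebra.single (π p) 1 := by
    intro p
    induction p using Finsupp.induction_linear with
    | zero => 
      rw [map_zero]
      exact map_one _
    | add f g hf hg =>
      rw [← one_mul (1 : K), ← monomial_mul, map_mul, hf, hg, AddMonoidAlgebra.single_mul_single,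
        map_add]
    | single e n =>
      have : (monomial (Finsupp.single e n) (1 : K)) = X e ^ n := (X_pow_eq_monomial).symm
      rw [this, map_pow, binHom, aeval_X, AddMonoidAlgebra.single_pow, one_pow, ← map_nsmul]
      simp
  have : monomial p c = C c * monomial p 1 := by rw [C_mul_monomial, mul_one]
  rw [this, map_mul, h]
  have : binHom K π (C c) = AddMonoidAlgebra.single 0 c := by
    rw [binHom, ← algebraMap_eq, AlgHom.commutes]
    rfl
  rw [this, AddMonoidAlgebra.single_mul_single]
  simp

/-- The binomial ideal of an additive map. -/
def binIdeal (K : Type*) [Field K] {E A : Type*} [AddCommMonoid A] (π : (E →₀ ℕ) →+ A) :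
    Ideal (MvPolynomial E K) := RingHom.ker (binHom K π)

theorem bin_mem {A : Type*} [AddCommMonoid A] (π : (E →₀ ℕ) →+ A) (p p' : E →₀ ℕ)
    (h : π p = π p') : monomial p (1 : K) - monomial p' 1 ∈ binIdeal K π := by
  rw [binIdeal, RingHom.mem_ker, map_sub, binHom_monomial, binHom_monomial, h, sub_self]

theorem binIdeal_le_submodule {A : Type*} [AddCommMonoid A] (π : (E →₀ ℕ) →+ A)
    (J : Submodule K (MvPolynomial E K))
    (hJ : ∀ p p', π p = π p' → monomial p (1 : K) - monomial p' 1 ∈ J) :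
    ∀ z ∈ binIdeal K π, z ∈ J := by
  have hrep : ∀ a : A, ∃ q : E →₀ ℕ, ∀ p, π p = a → π q = a := by
    intro a
    by_cases h : ∃ p, π p = a
    · obtain ⟨p, hp⟩ := h
      exact ⟨p, fun _ _ => hp⟩
    · exact ⟨0, fun p hp => absurd ⟨p, hp⟩ h⟩
  choose rep hrep using hrep
  let σ : AddMonoidAlgebra K A → MvPolynomial E K := fun w =>
    w.coeff.sum fun a c => monomial (rep a) c
  have hadd : ∀ w w', σ (w + w') = σ w + σ w' := by
    intro w w'
    exact Finsupp.sum_add_index' (by simp) (by simp)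
  have key : ∀ z : MvPolynomial E K, z - σ (binHom K π z) ∈ J := by
    intro z
    induction z using MvPolynomial.induction_on' with
    | monomial p c =>
      rw [binHom_monomial]
      have h1 : σ (AddMonoidAlgebra.single (π p) c) = monomial (rep (π p)) c := by
        show Finsupp.sum (Finsupp.single (π p) c) _ = _
        rw [Finsupp.sum_single_index]
        simp
      rw [h1]
      have h2 := J.smul_mem c (hJ p (rep (π p)) (hrep (π p) p rfl).symm)
      simpa [smul_sub, smul_monomial] using h2
    | add f g hf hg =>
      rw [map_add, hadd, add_sub_add_comm]
      exact J.add_mem hf hg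
  intro z hz
  have h0 : binHom K π z = 0 := hz
  have := key z
  rw [h0] at this
  simpa [σ] using this


theorem binIdeal_le {A : Type*} [AddCommMonoid A] (π : (E →₀ ℕ) →+ A)
    (J : Ideal (MvPolynomial E K))
    (hJ : ∀ p p', π p = π p' → monomial p (1 : K) - monomial p' 1 ∈ J) :
    binIdeal K π ≤ J :=
  binIdeal_le_submodule π (J.restrictScalars K) hJ

/-- the inclusion of exponents into the integer lattice -/
def expo : (E →₀ ℕ) →+ (E → ℤ) where
  toFun p e := (p e : ℤ)
  map_zero' := by ext; simp
  map_add' p q := by ext; simp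

theorem expo_apply (p : E →₀ ℕ) (e : E) : expo p e = (p e : ℤ) := rfl

/-- the lattice ideal -/
def latIdeal (K : Type*) [Field K] {E : Type*} (H : Submodule ℤ (E → ℤ)) :
    Ideal (MvPolynomial E K) :=
  binIdeal K (H.mkQ.toAddMonoidHom.comp expo)

theorem lat_eq_iff (H : Submodule ℤ (E → ℤ)) (p p' : E →₀ ℕ) :
    (H.mkQ.toAddMonoidHom.comp expo) p = (H.mkQ.toAddMonoidHom.comp expo) p' ↔
      expo p - expo p' ∈ H := by
  simp [Submodule.Quotient.eq]

theorem addMonoidAlgebra_reg {A : Type*} [AddCommGroup A] (a b : A)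
    (hab : ∀ n : ℕ, n • (a - b) = 0 → n = 0) (w : AddMonoidAlgebra K A)
    (hw : (AddMonoidAlgebra.single a 1 - AddMonoidAlgebra.single b 1) * w = 0) : w = 0 := by
  by_contra hne
  have h1 : ∀ t, w.coeff (-a + t) = w.coeff (-b + t) := by
    intro t
    have := congrArg (fun z => z.coeff t) hw
    simp only [sub_mul] at this
    have h2 : (AddMonoidAlgebra.single a 1 * w).coeff t - (AddMonoidAlgebra.single b 1 * w).coeff t
      = 0 := this
    rw [AddMonoidAlgebra.coeff_single_mul_apply, AddMonoidAlgebra.coeff_single_mul_apply] at h2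
    simpa [sub_eq_zero] using h2
  have h2 : ∀ s, w.coeff (s + (a - b)) = w.coeff s := by
    intro s
    have := h1 (s + a)
    rw [show -a + (s + a) = s by abel, show -b + (s + a) = s + (a - b) by abel] at this
    exact this.symm
  have h3 : ∀ (n : ℕ) s, w.coeff (s + n • (a - b)) = w.coeff s := by
    intro n
    induction n with
    | zero => simp
    | succ n ih =>
      intro s
      rw [succ_nsmul, ← add_assoc, h2, ih]
  have h4 : ∃ s, w.coeff s ≠ 0 := by
    by_contra hcon
    push Not at hcon
    apply hne
    apply AddMonoidAlgebra.coeff_injective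
    ext s
    exact hcon s
  obtain ⟨s, hs⟩ := h4
  have hinj : Function.Injective (fun n : ℕ => (⟨s + n • (a - b), by
      rw [Finsupp.mem_support_iff, h3]; exact hs⟩ : w.coeff.support)) := by
    have aux : ∀ n m : ℕ, n ≤ m → s + n • (a - b) = s + m • (a - b) → n = m := by
      intro n m hle h
      have h' := add_left_cancel h
      have := hab (m - n) (by rw [sub_nsmul _ hle, h', add_neg_cancel])
      omega
    intro n m h
    have h' : s + n • (a - b) = s + m • (a - b) := congrArg Subtype.val h
    rcases le_total n m with hle | hle
    · exact aux n m hle h'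
    · exact (aux m n hle h'.symm).symm
  exact not_injective_infinite_finite _ hinj

variable [Fintype E]

/-- the product of all variables -/
def prodX (K E : Type*) [Field K] [Fintype E] : MvPolynomial E K := ∏ e, X e

theorem monomial_dvd_prodX (p : E →₀ ℕ) : ∃ k : ℕ, monomial p (1 : K) ∣ prodX K E ^ k := by
  refine ⟨∑ e, p e, ?_⟩
  have h : monomial p (1 : K) = ∏ e, X e ^ p e := by
    rw [monomial_eq, C_1, one_mul, Finsupp.prod_fintype]
    simp
  rw [h, prodX, ← Finset.prod_pow]
  refine Finset.prod_dvd_prod_of_dvd _ _ fun e _ => pow_dvd_pow _ ?_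
  exact Finset.single_le_sum (f := fun e => p e) (fun _ _ => Nat.zero_le _) (Finset.mem_univ e)

theorem uniform_pow {R : Type*} [CommRing R] [IsNoetherianRing R] (x : R) (J Q : Ideal R)
    (h : ∀ z ∈ J, ∃ k : ℕ, x ^ k * z ∈ Q) : ∃ k : ℕ, ∀ z ∈ J, x ^ k * z ∈ Q := by
  obtain ⟨t, ht⟩ := (isNoetherianRing_iff_ideal_fg R).1 inferInstance J
  choose! k hk using h
  refine ⟨∑ z ∈ t, k z, ?_⟩
  have : J ≤ Submodule.comap (LinearMap.lsmul R R (x ^ (∑ z ∈ t, k z))) Q := by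
    rw [← ht]
    refine Submodule.span_le.2 fun z hz => ?_
    show x ^ (∑ z ∈ t, k z) * z ∈ Q
    rw [← Finset.add_sum_erase t k hz, add_comm, pow_add, mul_assoc]
    exact Q.mul_mem_left _ (hk z (by rw [← ht]; exact Submodule.subset_span hz))
  exact fun z hz => this hz

/-- torsion ideal with respect to powers of x -/
def satIdeal {R : Type*} [CommRing R] (x : R) (Q : Ideal R) : Ideal R where
  carrier := {z | ∃ k : ℕ, x ^ k * z ∈ Q}
  zero_mem' := ⟨0, by simp⟩
  add_mem' := by
    rintro a b ⟨k, hk⟩ ⟨l, hl⟩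
    refine ⟨k + l, ?_⟩
    have : x ^ (k + l) * (a + b) = x ^ l * (x ^ k * a) + x ^ k * (x ^ l * b) := by ring
    rw [this]
    exact Q.add_mem (Q.mul_mem_left _ hk) (Q.mul_mem_left _ hl)
  smul_mem' := by
    rintro c a ⟨k, hk⟩
    refine ⟨k, ?_⟩
    have : x ^ k * (c • a) = c * (x ^ k * a) := by simp; ring
    rw [this]
    exact Q.mul_mem_left _ hk

theorem exists_expo_sub (h : E → ℤ) : ∃ u v : E →₀ ℕ, expo u - expo v = h := by
  refine ⟨Finsupp.equivFunOnFinite.symm fun e => (h e).toNat,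
    Finsupp.equivFunOnFinite.symm fun e => (-h e).toNat, ?_⟩
  ext e
  simp [expo_apply]

theorem latIdeal_mono {H H' : Submodule ℤ (E → ℤ)} (hle : H ≤ H') :
    latIdeal K H ≤ latIdeal K H' := by
  refine binIdeal_le _ _ fun p p' hp => bin_mem _ _ _ ?_
  rw [lat_eq_iff] at hp ⊢
  exact hle hp

theorem RegChain.latStep {n : ℕ} (H : Submodule ℤ (E → ℤ)) (h : E → ℤ)
    (hh : ∀ n : ℤ, n • h ∈ H → n = 0) (hc : RegChain (prodX K E) n (latIdeal K H)) :
    RegChain (prodX K E) (n + 1) (latIdeal K (H ⊔ Submodule.span ℤ {h})) := by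
  obtain ⟨u, v, huv⟩ := exists_expo_sub h
  set f : MvPolynomial E K := monomial u 1 - monomial v 1 with hf
  set Q := latIdeal K H ⊔ Ideal.span {f} with hQ
  have hfQ : f ∈ Q := Ideal.mem_sup_right (Ideal.mem_span_singleton_self f)
  have main : ∀ (j : ℕ) (p p' : E →₀ ℕ), expo p - expo p' - (j : ℤ) • h ∈ H →
      monomial p (1 : K) - monomial p' 1 ∈ satIdeal (prodX K E) Q := by
    intro j p p' hj
    have h1 : monomial (p + j • v) (1 : K) - monomial (p' + j • u) 1 ∈ Q := by
      refine Ideal.mem_sup_left (bin_mem _ _ _ ?_)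
      rw [lat_eq_iff]
      convert hj using 1
      rw [map_add, map_add, map_nsmul, map_nsmul, ← huv]
      simp only [natCast_zsmul, smul_sub]
      abel
    have h2 : monomial (j • u) (1 : K) - monomial (j • v) 1 ∈ Q := by
      refine Ideal.mem_sup_right (Ideal.mem_span_singleton.2 ?_)
      have : ∀ w : E →₀ ℕ, monomial (j • w) (1 : K) = monomial w 1 ^ j := by
        intro w; rw [monomial_pow, one_pow]
      rw [this, this]
      exact sub_dvd_pow_sub_pow _ _ _
    have h3 : monomial (j • v) (1 : K) * (monomial p 1 - monomial p' 1) ∈ Q := by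
      have : monomial (j • v) (1 : K) * (monomial p 1 - monomial p' 1) =
          (monomial (p + j • v) (1 : K) - monomial (p' + j • u) 1) +
          monomial p' 1 * (monomial (j • u) (1 : K) - monomial (j • v) 1) := by
        simp only [mul_sub, monomial_mul, mul_one, add_comm]
        abel
      rw [this]
      exact Q.add_mem h1 (Q.mul_mem_left _ h2)
    obtain ⟨k, m, hm⟩ := monomial_dvd_prodX (K := K) (j • v)
    refine ⟨k, ?_⟩
    rw [hm, mul_comm _ m, mul_assoc]
    exact Q.mul_mem_left _ h3
  have hsat : latIdeal K (H ⊔ Submodule.span ℤ {h}) ≤ satIdeal (prodX K E) Q := by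
    refine binIdeal_le _ _ fun p p' hp => ?_
    rw [lat_eq_iff] at hp
    obtain ⟨g, hg, y, hy, hgy⟩ := Submodule.mem_sup.1 hp
    obtain ⟨j, rfl⟩ := Submodule.mem_span_singleton.1 hy
    rcases Int.eq_nat_or_neg j with ⟨k, rfl | rfl⟩
    · refine main k p p' ?_
      rw [← hgy]; simpa using hg
    · have := main k p' p (by
        rw [← neg_sub (expo p) (expo p'), ← hgy]
        have := H.neg_mem hg
        convert this using 1
        simp)
      rw [← neg_sub]
      exact neg_mem this
  obtain ⟨k, hk⟩ := uniform_pow (prodX K E) (latIdeal K (H ⊔ Submodule.span ℤ {h})) Q hsat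
  refine RegChain.succ f k hc ?_ ?_ (latIdeal_mono le_sup_left) hk
  · intro z hz
    have hz' : binHom K _ (f * z) = 0 := hz
    rw [map_mul, hf, map_sub, binHom_monomial, binHom_monomial] at hz'
    refine addMonoidAlgebra_reg _ _ ?_ _ hz'
    intro n hn
    have : (n : ℤ) • h ∈ H := by
      rw [← Submodule.Quotient.mk_eq_zero, ← huv, natCast_zsmul]
      exact hn
    exact_mod_cast hh n this
  · refine bin_mem _ _ _ ?_
    rw [lat_eq_iff, huv]
    exact Submodule.mem_sup_right (Submodule.mem_span_singleton_self h)

theorem latIdeal_bot : latIdeal K (⊥ : Submodule ℤ (E → ℤ)) = ⊥ := by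
  rw [eq_bot_iff]
  refine binIdeal_le _ _ fun p p' hp => ?_
  rw [lat_eq_iff, Submodule.mem_bot, sub_eq_zero] at hp
  have : p = p' := by
    ext e
    have := congrFun hp e
    rw [expo_apply, expo_apply] at this
    exact_mod_cast this
  rw [this, sub_self]
  exact zero_mem _

theorem regChain_lat : ∀ (n : ℕ) (b : Fin n → (E → ℤ)), LinearIndependent ℤ b →
    RegChain (prodX K E) n (latIdeal K (Submodule.span ℤ (Set.range b))) := by
  intro n
  induction n with
  | zero =>
    intro b _
    rw [Set.range_eq_empty, Submodule.span_empty, latIdeal_bot]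
    exact RegChain.zero
  | succ n ih =>
    intro b hb
    have h1 := ih (fun i => b i.castSucc) (hb.comp _ (Fin.castSucc_injective n))
    have h2 := RegChain.latStep _ (b (Fin.last n)) ?_ h1
    · convert h2 using 2
      rw [← Submodule.span_union]
      congr 1
      ext z
      simp [Fin.exists_fin_succ', or_comm, eq_comm]
    · intro m hm
      refine hb.eq_zero_of_smul_mem_span (Fin.last n) m (Submodule.span_mono ?_ hm)
      rintro _ ⟨i, rfl⟩
      exact ⟨i.castSucc, by simp [Fin.castSucc_ne_last], rfl⟩

end PartD
section PartE

theorem lat_lower {E : Type u} {K : Type v} [Field K] [Fintype E] {n : ℕ} (H : Submodule ℤ (E → ℤ))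
    (hc : RegChain (prodX K E) n (latIdeal K H)) :
    ¬ HasProjectiveDimensionLT
      (ModuleCat.of (MvPolynomial E K) (MvPolynomial E K ⧸ latIdeal K H)) n := by
  intro hpd
  let φ := binHom K (H.mkQ.toAddMonoidHom.comp (expo (E := E)))
  let _ : Module (MvPolynomial E K) (AddMonoidAlgebra K ((E → ℤ) ⧸ H)) :=
    Module.compHom _ φ.toRingHom
  have hsm : ∀ (s : MvPolynomial E K) (l : AddMonoidAlgebra K ((E → ℤ) ⧸ H)), s • l = φ s * l :=
    fun s l => rfl
  have hu : IsUnit (φ (prodX K E)) := by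
    rw [prodX, map_prod]
    refine Finset.prod_induction _ IsUnit (fun a b => IsUnit.mul) isUnit_one fun e _ => ?_
    have : φ (X e) = AddMonoidAlgebra.single _ 1 := aeval_X _ _
    rw [this]
    generalize (H.mkQ.toAddMonoidHom.comp expo) (Finsupp.single e 1) = a
    refine IsUnit.of_mul_eq_one (AddMonoidAlgebra.single (-a) 1) ?_
    rw [AddMonoidAlgebra.single_mul_single, add_neg_cancel, one_mul]
    rfl
  obtain ⟨w, hw⟩ := hu.exists_right_inv
  let L := ModuleCat.of (MvPolynomial E K) (AddMonoidAlgebra K ((E → ℤ) ⧸ H))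
  let y : L ⟶ L := ModuleCat.ofHom
    { toFun := fun l => (w * l : AddMonoidAlgebra K ((E → ℤ) ⧸ H))
      map_add' := fun a b => mul_add _ _ _
      map_smul' := fun s a => by
        show w * (φ s * a) = φ s * (w * a)
        ring }
  have : Nontrivial L := inferInstanceAs (Nontrivial (AddMonoidAlgebra K ((E → ℤ) ⧸ H)))
  obtain ⟨e, he⟩ := hc.lower L y (by
    apply ModuleCat.hom_ext; apply LinearMap.ext; intro l
    show w * (φ (prodX K E) * l) = l
    rw [← mul_assoc, mul_comm w, hw, one_mul]) (by
    intro z hz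
    apply ModuleCat.hom_ext; apply LinearMap.ext; intro l
    show φ z * l = (0 : AddMonoidAlgebra K ((E → ℤ) ⧸ H))
    have : φ z = 0 := hz
    rw [this, zero_mul])
  exact he (Abelian.Ext.eq_zero_of_hasProjectiveDimensionLT e n le_rfl)

variable {V : Type*} [Fintype V]

/-- the boundary map -/
def bd (R : Type*) [CommRing R] {V : Type*} [Fintype V] (G : SimpleGraph V) :
    (G.edgeSet → R) →ₗ[R] (V → R) where
  toFun x v := ∑ e, x e * if v ∈ (e : Sym2 V) then 1 else 0
  map_add' x y := by
    ext v
    simp only [Pi.add_apply, add_mul, Finset.sum_add_distrib]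
  map_smul' c x := by
    ext v
    simp [Finset.mul_sum]

theorem bd_apply (R : Type*) [CommRing R] (G : SimpleGraph V) (x : G.edgeSet → R) (v : V) :
    bd R G x v = ∑ e, x e * if v ∈ (e : Sym2 V) then 1 else 0 := rfl

/-- exponent of an edge -/
def edgeExp (e : Sym2 V) : V →₀ ℕ := Finsupp.equivFunOnFinite.symm fun v => if v ∈ e then 1 else 0

theorem edgeMon_eq (K : Type*) [Field K] (G : SimpleGraph V) (e : G.edgeSet) :
    edgeMon K (e : Sym2 V) = monomial (edgeExp (e : Sym2 V)) 1 := by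
  obtain ⟨e, he⟩ := e
  induction e with
  | h a b =>
    have hab : a ≠ b := G.ne_of_adj he
    show X a * X b = _
    rw [X, X, monomial_mul, one_mul]
    refine congrArg (fun w => monomial w (1 : K)) ?_
    ext v
    simp only [Finsupp.add_apply, Finsupp.single_apply, edgeExp, Finsupp.equivFunOnFinite_symm_apply_apply,
      Sym2.mem_iff]
    by_cases h1 : a = v
    · subst h1
      simp [hab.symm]
    · by_cases h2 : b = v
      · subst h2
        simp [hab]
      · simp [h1, h2, Ne.symm h1, Ne.symm h2]

/-- degree map on exponents -/
def dg (G : SimpleGraph V) : (G.edgeSet →₀ ℕ) →+ (V →₀ ℕ) where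
  toFun p := ∑ e, p e • edgeExp (e : Sym2 V)
  map_zero' := by simp
  map_add' p q := by simp [add_smul, Finset.sum_add_distrib]

theorem dg_cast (G : SimpleGraph V) (p : G.edgeSet →₀ ℕ) (v : V) :
    ((dg G p v : ℕ) : ℤ) = bd ℤ G (expo p) v := by
  simp [dg, bd_apply, expo_apply, edgeExp]

theorem dg_eq_iff (G : SimpleGraph V) (p p' : G.edgeSet →₀ ℕ) :
    dg G p = dg G p' ↔ expo p - expo p' ∈ LinearMap.ker (bd ℤ G) := by
  rw [LinearMap.mem_ker, map_sub, sub_eq_zero]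
  constructor
  · intro h
    ext v
    rw [← dg_cast, ← dg_cast, h]
  · intro h
    ext v
    have := congrFun h v
    rw [← dg_cast, ← dg_cast] at this
    exact_mod_cast this

theorem edgeHom_monomial (K : Type*) [Field K] (G : SimpleGraph V) (p : G.edgeSet →₀ ℕ) (c : K) :
    edgeHom K G (monomial p c) = monomial (dg G p) c := by
  rw [edgeHom, aeval_monomial, Finsupp.prod_fintype _ _ (by simp)]
  simp only [edgeMon_eq, monomial_pow, one_pow, algebraMap_eq]
  have : ∀ s : Finset G.edgeSet, ∏ e ∈ s, (monomial (p e • edgeExp (e : Sym2 V)) (1 : K)) =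
      monomial (∑ e ∈ s, p e • edgeExp (e : Sym2 V)) 1 := by
    intro s
    exact (monomial_sum_one s _).symm
  rw [this, C_mul_monomial, mul_one]
  rfl

theorem toric_eq_bin (K : Type*) [Field K] (G : SimpleGraph V) :
    toricIdeal K G = binIdeal K (dg G) := by
  have h : ∀ z, edgeHom K G z = binHom K (dg G) z := by
    intro z
    induction z using MvPolynomial.induction_on' with
    | monomial p c => rw [edgeHom_monomial, binHom_monomial]; rfl
    | add f g hf hg => rw [map_add, map_add, hf, hg]
  ext z
  show edgeHom K G z = 0 ↔ binHom K (dg G) z = 0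
  rw [h]

theorem toric_eq_lat (K : Type*) [Field K] (G : SimpleGraph V) :
    toricIdeal K G = latIdeal K (LinearMap.ker (bd ℤ G)) := by
  rw [toric_eq_bin]
  refine le_antisymm ?_ ?_
  · refine binIdeal_le _ _ fun p p' h => bin_mem _ _ _ ?_
    rwa [lat_eq_iff, ← dg_eq_iff]
  · refine binIdeal_le _ _ fun p p' h => bin_mem _ _ _ ?_
    rwa [dg_eq_iff, ← lat_eq_iff]

theorem toric_regChain (K : Type*) [Field K] (G : SimpleGraph V) :
    RegChain (prodX K G.edgeSet) (Module.finrank ℤ (LinearMap.ker (bd ℤ G))) (toricIdeal K G) := by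
  let b := Module.finBasis ℤ (LinearMap.ker (bd ℤ G))
  have h1 : LinearIndependent ℤ (fun i => (b i : G.edgeSet → ℤ)) :=
    b.linearIndependent.map' (LinearMap.ker (bd ℤ G)).subtype (Submodule.ker_subtype _)
  have h2 := regChain_lat (K := K) _ _ h1
  have h3 : Submodule.span ℤ (Set.range (fun i => (b i : G.edgeSet → ℤ))) =
      LinearMap.ker (bd ℤ G) := by
    have := b.span_eq
    have h4 := congrArg (Submodule.map (LinearMap.ker (bd ℤ G)).subtype) this
    rw [Submodule.map_span, ← Set.range_comp] at h4
    simp only [Submodule.map_top, Submodule.range_subtype] at h4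
    exact h4
  rw [h3] at h2
  rw [toric_eq_lat]
  exact h2

end PartE
section PartF

theorem semilin {E : Type*} {K : Type*} [Field K] {T : Type*} [AddCommGroup T] [Module K T]
    [Module (MvPolynomial E K) T] [IsScalarTower K (MvPolynomial E K) T] (t : T) (q : ℕ)
    (P : (E →₀ ℕ) → (E →₀ ℕ) → Prop)
    (h1 : ∀ p w w', P p w → P p w' → monomial w (1 : K) • t = monomial w' (1 : K) • t)
    (h2 : ∀ p w s, P p w → P (q • s + p) (s + w))
    (h3 : ∀ p w s, P (q • s + p) w → ∃ w', P p w') :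
    ∃ ρ : MvPolynomial E K →ₗ[K] T, (∀ s z, ρ (expand q s * z) = s • ρ z) ∧
      (∀ p w, P p w → ρ (monomial p 1) = monomial w (1 : K) • t) ∧
      (∀ p, (¬ ∃ w, P p w) → ρ (monomial p 1) = 0) := by
  let θ : (E →₀ ℕ) → T := fun p => if h : ∃ w, P p w then monomial h.choose (1 : K) • t else 0
  let ρ := (basisMonomials E K).constr K θ
  have hρ : ∀ p, ρ (monomial p 1) = θ p := by
    intro p
    have := (basisMonomials E K).constr_basis K θ p
    rwa [coe_basisMonomials] at this
  have hρ1 : ∀ p w, P p w → ρ (monomial p 1) = monomial w (1 : K) • t := by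
    intro p w h
    have h' : ∃ w, P p w := ⟨w, h⟩
    rw [hρ]
    simp only [θ, dif_pos h']
    exact h1 p _ _ h'.choose_spec h
  have hρ0 : ∀ p, (¬ ∃ w, P p w) → ρ (monomial p 1) = 0 := by
    intro p h
    rw [hρ]
    simp only [θ, dif_neg h]
  have hmon : ∀ (p : E →₀ ℕ) (c : K), monomial p c = c • monomial p (1 : K) := by
    intro p c; simp [smul_monomial]
  refine ⟨ρ, ?_, hρ1, hρ0⟩
  have base : ∀ s p, ρ (expand q (monomial s 1) * monomial p 1) = monomial s (1 : K) • ρ (monomial p 1) := by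
    intro s p
    rw [expand_monomial, monomial_mul, one_mul]
    by_cases h : ∃ w, P p w
    · obtain ⟨w, hw⟩ := h
      rw [hρ1 p w hw, hρ1 _ _ (h2 p w s hw), smul_smul, monomial_mul, one_mul]
    · rw [hρ0 p h, hρ0 _ (fun ⟨w, hw⟩ => h (h3 p w s hw)), smul_zero]
  intro s z
  induction s using MvPolynomial.induction_on' with
  | add f g hf hg => rw [map_add, add_mul, map_add, hf, hg, add_smul]
  | monomial s c =>
    induction z using MvPolynomial.induction_on' with
    | add f g hf hg => rw [mul_add, map_add, hf, hg, map_add, smul_add]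
    | monomial p d =>
      rw [hmon s c, hmon p d, map_smul, smul_mul_smul_comm, map_smul, base, map_smul, smul_assoc,
        mul_comm c d, mul_smul, smul_comm d c, smul_comm d (monomial s (1 : K))]

theorem expand_projective {E : Type u} {K : Type v} [Fintype E] [Field K] (q : ℕ) (hq : 0 < q) :
    Projective ((ModuleCat.restrictScalars.{max u v}
      (expand q : MvPolynomial E K →ₐ[K] MvPolynomial E K).toRingHom).obj
      (ModuleCat.of (MvPolynomial E K) (MvPolynomial E K))) := by
  let fr : (E → Fin q) → (E →₀ ℕ) := fun r => Finsupp.equivFunOnFinite.symm fun e => (r e : ℕ)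
  have hfr : ∀ r e, fr r e = (r e : ℕ) := fun r e => rfl
  have hex : ∀ r : E → Fin q, ∃ ρ : MvPolynomial E K →ₗ[K] MvPolynomial E K,
      (∀ s z, ρ (expand q s * z) = s • ρ z) ∧
      (∀ p w, p = fr r + q • w → ρ (monomial p 1) = monomial w (1 : K) • 1) ∧
      (∀ p, (¬ ∃ w, p = fr r + q • w) → ρ (monomial p 1) = 0) := by
    intro r
    refine semilin 1 q (fun p w => p = fr r + q • w) ?_ ?_ ?_
    · rintro p w w' rfl h
      have : w = w' := by
        ext e
        have := DFunLike.congr_fun h e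
        simp only [Finsupp.add_apply, Finsupp.smul_apply, smul_eq_mul] at this
        exact Nat.eq_of_mul_eq_mul_left hq (by omega)
      rw [this]
    · rintro p w s rfl
      rw [smul_add]; abel
    · intro p w s h
      refine ⟨w - s, ?_⟩
      ext e
      have h := DFunLike.congr_fun h e
      have h5 := (r e).2
      simp only [Finsupp.add_apply, Finsupp.smul_apply, smul_eq_mul, Finsupp.tsub_apply, hfr] at h ⊢
      have hle : s e ≤ w e := by
        by_contra hlt
        have : q * (w e + 1) ≤ q * s e := Nat.mul_le_mul_left q (by omega)
        rw [mul_add] at this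
        omega
      rw [Nat.mul_sub]
      have := Nat.mul_le_mul_left q hle
      omega
  choose lam hl1 hl2 hl3 using hex
  have hsum : ∀ z : MvPolynomial E K, ∑ r, expand q (lam r z) * monomial (fr r) 1 = z := by
    intro z
    induction z using MvPolynomial.induction_on' with
    | add f g hf hg =>
      simp only [map_add, add_mul, Finset.sum_add_distrib, hf, hg]
    | monomial p c =>
      have hmon : monomial p c = c • monomial p (1 : K) := by simp [smul_monomial]
      rw [hmon]
      simp only [map_smul, smul_mul_assoc, ← Finset.smul_sum]
      congr 1
      let r0 : E → Fin q := fun e => ⟨p e % q, Nat.mod_lt _ hq⟩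
      let w : E →₀ ℕ := Finsupp.equivFunOnFinite.symm fun e => p e / q
      have hp : p = fr r0 + q • w := by
        ext e
        exact (Nat.mod_add_div (p e) q).symm
      rw [Finset.sum_eq_single r0]
      · rw [hl2 r0 p w hp, smul_eq_mul, mul_one, expand_monomial, monomial_mul, one_mul, add_comm, ← hp]
      · intro r _ hr
        rw [hl3 r p, map_zero, zero_mul]
        rintro ⟨w', hw'⟩
        apply hr
        ext e
        have := DFunLike.congr_fun hw' e
        simp only [Finsupp.add_apply, Finsupp.smul_apply, smul_eq_mul, hfr] at this
        show _ = p e % q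
        rw [this, Nat.add_mul_mod_self_left, Nat.mod_eq_of_lt (r e).2]
      · simp
  let Φ := (expand q : MvPolynomial E K →ₐ[K] MvPolynomial E K).toRingHom
  let Mo := (ModuleCat.restrictScalars.{max u v} Φ).obj
      (ModuleCat.of (MvPolynomial E K) (MvPolynomial E K))
  let i : Mo →ₗ[MvPolynomial E K] ((E → Fin q) → MvPolynomial E K) :=
    { toFun := fun z r => lam r (show MvPolynomial E K from z)
      map_add' := fun a b => by
        ext1 r
        exact map_add (lam r) _ _
      map_smul' := fun s a => by
        ext1 r
        exact hl1 r s _ }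
  let s : ((E → Fin q) → MvPolynomial E K) →ₗ[MvPolynomial E K] Mo :=
    { toFun := fun a => (show MvPolynomial E K from ∑ r, expand q (a r) * monomial (fr r) 1)
      map_add' := fun a b => by
        show (∑ r, expand q (a r + b r) * monomial (fr r) 1 : MvPolynomial E K) =
          (∑ r, expand q (a r) * monomial (fr r) 1) + (∑ r, expand q (b r) * monomial (fr r) 1)
        simp only [map_add, add_mul, Finset.sum_add_distrib]
      map_smul' := fun c a => by
        show (∑ r, expand q (c * a r) * monomial (fr r) 1 : MvPolynomial E K) =
          expand q c * (∑ r, expand q (a r) * monomial (fr r) 1)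
        simp only [map_mul, Finset.mul_sum, mul_assoc] }
  have hproj : Module.Projective (MvPolynomial E K) Mo :=
    Module.Projective.of_split i s (LinearMap.ext fun z => hsum z)
  exact (IsProjective.iff_projective Mo).1 hproj

theorem hasPD_of_split {S : Type u} [CommRing S] (I : Ideal S) (Φ : S →+* S)
    (hexp : I ≤ Ideal.comap Φ I) (ρ : S →+ S ⧸ I) (hρ : ∀ s z, ρ (Φ s * z) = s • ρ z)
    (hkill : ∀ z ∈ I, ρ z = 0) (b : S) (hb : ρ b = Ideal.Quotient.mk I 1) (n : ℕ)
    (h : ExtNull n ((ModuleCat.restrictScalars.{u} Φ).map (b • 𝟙 (ModuleCat.of S (S ⧸ I))))) :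
    HasProjectiveDimensionLT (ModuleCat.of S (S ⧸ I)) (n + 1) := by
  let φ0 : S ⧸ I →+* S ⧸ I := Ideal.quotientMap I Φ hexp
  let M := ModuleCat.of S (S ⧸ I)
  let F := ModuleCat.restrictScalars.{u} Φ
  let φ : M ⟶ F.obj M := ModuleCat.ofHom (X := M) (Y := F.obj M)
    { toFun := fun z => (φ0 z : S ⧸ I)
      map_add' := fun a b => map_add φ0 a b
      map_smul' := fun s a => by
        show φ0 (s • a) = Φ s • φ0 a
        obtain ⟨a, rfl⟩ := Ideal.Quotient.mk_surjective a
        exact congrArg (Ideal.Quotient.mk I) (map_mul Φ s a) }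
  let r0 : S ⧸ I →+ S ⧸ I := QuotientAddGroup.lift _ ρ hkill
  let r : F.obj M ⟶ M := ModuleCat.ofHom (X := F.obj M) (Y := M)
    { toFun := fun z => r0 (show S ⧸ I from z)
      map_add' := fun a b => map_add r0 a b
      map_smul' := fun s a => by
        show r0 (Φ s • (show S ⧸ I from a)) = s • r0 (show S ⧸ I from a)
        generalize (show S ⧸ I from a) = a
        obtain ⟨a, rfl⟩ := Ideal.Quotient.mk_surjective a
        exact hρ s a }
  have hid : (φ ≫ F.map (b • 𝟙 M)) ≫ r = 𝟙 M := by
    apply ModuleCat.hom_ext; apply LinearMap.ext; intro z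
    obtain ⟨z, rfl⟩ := Ideal.Quotient.mk_surjective z
    show r0 (b • (Ideal.Quotient.mk I (Φ z))) = Ideal.Quotient.mk I z
    have h5 : b • (Ideal.Quotient.mk I (Φ z)) = Ideal.Quotient.mk I (Φ z * b) := by
      rw [mul_comm]; rfl
    rw [h5]
    show ρ (Φ z * b) = _
    rw [hρ, hb]
    exact congrArg (Ideal.Quotient.mk I) (mul_one z)
  refine ExtNull.hasPD ?_
  rw [← hid]
  exact (h.precomp φ).postcomp r

theorem toric_upper (K : Type v) [Field K] {V : Type u} [Fintype V] (G : SimpleGraph V)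
    (hG : ∀ b0 : G.edgeSet →₀ ℕ, ∃ q : ℕ, 0 < q ∧ ∀ p s p' : G.edgeSet →₀ ℕ,
      dg G p + q • dg G s = dg G b0 + q • dg G p' → ∃ w, dg G p = dg G b0 + q • dg G w) (n : ℕ)
    (hc : RegChain (prodX K G.edgeSet) n (toricIdeal K G)) :
    HasProjectiveDimensionLT
      (ModuleCat.of (MvPolynomial G.edgeSet K) (edgeRing K G)) (n + 1) := by
  obtain ⟨N, hN⟩ := hc.upper
  let b0 : G.edgeSet →₀ ℕ := Finsupp.equivFunOnFinite.symm fun _ => N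
  have hb0 : prodX K G.edgeSet ^ N = monomial b0 1 := by
    rw [monomial_eq, C_1, one_mul, Finsupp.prod_fintype _ _ (by simp), prodX, ← Finset.prod_pow]
    rfl
  obtain ⟨q, hq, hqP⟩ := hG b0
  have hmk : ∀ w : MvPolynomial G.edgeSet K, w • (1 : edgeRing K G) = Ideal.Quotient.mk _ w := by
    intro w
    exact congrArg (Ideal.Quotient.mk (toricIdeal K G)) (mul_one w)
  obtain ⟨ρ, hρ1, hρ2, hρ3⟩ := semilin (K := K) (1 : edgeRing K G) q
    (fun p w => dg G p = dg G b0 + q • dg G w) (by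
      intro p w w' h h'
      rw [h'] at h
      have h4 : dg G w' = dg G w := by
        ext v
        have := DFunLike.congr_fun h v
        simp only [Finsupp.add_apply, Finsupp.smul_apply, smul_eq_mul] at this
        exact Nat.eq_of_mul_eq_mul_left hq (by omega)
      rw [hmk, hmk]
      refine Ideal.Quotient.eq.2 ?_
      rw [toric_eq_bin]
      exact bin_mem _ _ _ h4.symm) (by
      intro p w s h
      rw [map_add, map_add, h, map_nsmul, smul_add]
      abel) (by
      intro p w s h
      rw [map_add, map_nsmul, add_comm] at h
      exact hqP _ _ _ h)
  have hkill : ∀ z ∈ toricIdeal K G, ρ z = 0 := by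
    intro z hz
    refine binIdeal_le_submodule (dg G) (LinearMap.ker ρ) ?_ z (toric_eq_bin K G ▸ hz)
    intro p p' h
    rw [LinearMap.mem_ker, map_sub, sub_eq_zero]
    by_cases hex : ∃ w, dg G p = dg G b0 + q • dg G w
    · obtain ⟨w, hw⟩ := hex
      rw [hρ2 p w hw, hρ2 p' w (h ▸ hw)]
    · rw [hρ3 p hex, hρ3 p' (h ▸ hex)]
  have hexp : toricIdeal K G ≤ Ideal.comap (expand q).toRingHom (toricIdeal K G) := by
    conv_lhs => rw [toric_eq_bin]
    refine binIdeal_le _ _ fun p p' h => ?_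
    show expand q (monomial p (1 : K) - monomial p' 1) ∈ toricIdeal K G
    rw [map_sub, expand_monomial, expand_monomial, toric_eq_bin]
    refine bin_mem _ _ _ ?_
    rw [map_nsmul, map_nsmul, h]
  refine hasPD_of_split (toricIdeal K G) (expand q).toRingHom hexp ρ.toAddMonoidHom hρ1 hkill
    (prodX K G.edgeSet ^ N) ?_ n (hN _ (expand_projective q hq))
  rw [hb0]
  refine (hρ2 b0 0 (by simp)).trans ?_
  rw [hmk]
  rfl

end PartF
section PartH
variable {V : Type*} [Fintype V]

theorem bd_nonneg (G : SimpleGraph V) (r : G.edgeSet →₀ ℕ) (v : V) : 0 ≤ bd ℤ G (expo r) v := by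
  rw [← dg_cast]; positivity

theorem bd_le (G : SimpleGraph V) (r : G.edgeSet →₀ ℕ) (q : ℕ) (hr : ∀ e, r e ≤ q) (v : V) :
    bd ℤ G (expo r) v ≤ Fintype.card G.edgeSet * q := by
  rw [bd_apply]
  calc ∑ e, expo r e * (if v ∈ (e : Sym2 V) then 1 else 0) ≤ ∑ e : G.edgeSet, (q : ℤ) := by
        refine Finset.sum_le_sum fun e _ => ?_
        have := hr e
        rw [expo_apply]
        split_ifs <;> simp <;> omega
    _ = _ := by simp

theorem exists_q (G : SimpleGraph V)
    (hnorm : ∀ (x : G.edgeSet → ℤ) (k : ℕ) (c : G.edgeSet →₀ ℕ), 0 < k →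
      (k : ℤ) • bd ℤ G x = bd ℤ G (expo c) → ∃ w : G.edgeSet →₀ ℕ, bd ℤ G x = bd ℤ G (expo w))
    (b0 : G.edgeSet →₀ ℕ) : ∃ q : ℕ, 0 < q ∧ ∀ p s p' : G.edgeSet →₀ ℕ,
      dg G p + q • dg G s = dg G b0 + q • dg G p' → ∃ w, dg G p = dg G b0 + q • dg G w := by
  let Q : (V → ℤ) → Set ℕ := fun m => {q | ∃ c : G.edgeSet →₀ ℕ,
    bd ℤ G (expo c) = bd ℤ G (expo b0) + (q : ℤ) • m}
  let Bad : Set (V → ℤ) := {m | (∃ x, bd ℤ G x = m) ∧ ¬ ∃ w : G.edgeSet →₀ ℕ, m = bd ℤ G (expo w)}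
  have hfin : ∀ m ∈ Bad, (Q m).Finite := by
    rintro m ⟨⟨x, rfl⟩, hm⟩
    by_contra hinf
    have hinf : (Q (bd ℤ G x)).Infinite := hinf
    have hs : ∀ n : ℕ, ∃ c : G.edgeSet →₀ ℕ,
      bd ℤ G (expo c) = bd ℤ G (expo b0) + (Nat.nth (· ∈ Q (bd ℤ G x)) n : ℤ) • bd ℤ G x :=
      fun n => Nat.nth_mem_of_infinite hinf n
    choose c hc using hs
    obtain ⟨i, j, hij, hle⟩ := (wellQuasiOrdered_le (α := G.edgeSet → ℕ)) (fun n => ⇑(c n))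
    have hlt : Nat.nth (· ∈ Q (bd ℤ G x)) i < Nat.nth (· ∈ Q (bd ℤ G x)) j :=
      Nat.nth_strictMono hinf hij
    apply hm
    refine hnorm x (Nat.nth (· ∈ Q (bd ℤ G x)) j - Nat.nth (· ∈ Q (bd ℤ G x)) i) (c j - c i)
      (by omega) ?_
    have h1 : expo (c j - c i) = expo (c j) - expo (c i) := by
      ext e
      have := hle e
      simp only [Pi.sub_apply, expo_apply, Finsupp.tsub_apply]
      rw [Nat.cast_sub this]
    rw [h1, map_sub, hc, hc, Nat.cast_sub hlt.le, sub_smul]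
    abel
  let lo : V → ℤ := fun v => - bd ℤ G (expo b0) v
  let hi : V → ℤ := fun v => Fintype.card G.edgeSet
  have hfin2 : (⋃ m ∈ Set.Icc lo hi ∩ Bad, Q m).Finite :=
    Set.Finite.biUnion ((Set.finite_Icc lo hi).inter_of_left _) fun m hm => hfin m hm.2
  obtain ⟨q0, hq0⟩ := hfin2.bddAbove
  refine ⟨q0 + 1, Nat.succ_pos _, ?_⟩
  intro p s p' h
  set q := q0 + 1 with hq
  have hqpos : (1 : ℤ) ≤ q := by rw [hq]; push_cast; omega
  -- the integral form of the equation
  have hZ : bd ℤ G (expo p) = bd ℤ G (expo b0) + (q : ℤ) • bd ℤ G (expo p' - expo s) := by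
    ext v
    have := congrArg (fun z => ((z v : ℕ) : ℤ)) h
    simp only [Finsupp.add_apply, Finsupp.smul_apply, smul_eq_mul, Nat.cast_add, Nat.cast_mul,
      dg_cast] at this
    simp only [map_sub, Pi.add_apply, Pi.smul_apply, Pi.sub_apply, smul_eq_mul, mul_sub]
    linarith
  let f : G.edgeSet →₀ ℕ := Finsupp.equivFunOnFinite.symm fun e => p e / q
  let r : G.edgeSet →₀ ℕ := Finsupp.equivFunOnFinite.symm fun e => p e % q
  have hpr : expo p = (q : ℤ) • expo f + expo r := by
    ext e
    simp only [Pi.add_apply, Pi.smul_apply, expo_apply, smul_eq_mul]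
    show ((p e : ℕ) : ℤ) = q * ((p e / q : ℕ) : ℤ) + ((p e % q : ℕ) : ℤ)
    exact_mod_cast (Nat.div_add_mod (p e) q).symm
  set x := expo p' - expo s - expo f with hx
  have hr : bd ℤ G (expo r) = bd ℤ G (expo b0) + (q : ℤ) • bd ℤ G x := by
    rw [hpr, map_add, map_smul] at hZ
    rw [hx, map_sub, smul_sub, ← add_sub_assoc, ← hZ]
    abel
  have hB : bd ℤ G x ∈ Set.Icc lo hi := by
    constructor
    · intro v
      have h1 := congrFun hr v
      have h2 := bd_nonneg G r v
      have h3 := bd_nonneg G b0 v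
      simp only [Pi.add_apply, Pi.smul_apply, smul_eq_mul] at h1
      show - bd ℤ G (expo b0) v ≤ _
      by_contra hlt
      push Not at hlt
      nlinarith
    · intro v
      have h1 := congrFun hr v
      have h2 := bd_le G r q (fun e => (Nat.mod_lt _ (Nat.succ_pos _)).le) v
      have h3 := bd_nonneg G b0 v
      simp only [Pi.add_apply, Pi.smul_apply, smul_eq_mul] at h1
      show _ ≤ (Fintype.card G.edgeSet : ℤ)
      by_contra hlt
      push Not at hlt
      nlinarith
  have hnb : bd ℤ G x ∉ Bad := by
    intro hb
    have : q ∈ ⋃ m ∈ Set.Icc lo hi ∩ Bad, Q m := by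
      simp only [Set.mem_iUnion]
      exact ⟨_, ⟨hB, hb⟩, r, hr⟩
    have := hq0 this
    omega
  have hw : ∃ w : G.edgeSet →₀ ℕ, bd ℤ G x = bd ℤ G (expo w) := by
    by_contra hcon
    exact hnb ⟨⟨x, rfl⟩, hcon⟩
  obtain ⟨w, hw⟩ := hw
  refine ⟨w + f, ?_⟩
  ext v
  have h1 := congrFun hZ v
  have h2 := congrFun hw v
  rw [hx] at h2
  apply Nat.cast_injective (R := ℤ)
  simp only [map_sub, Pi.add_apply, Pi.smul_apply, Pi.sub_apply, smul_eq_mul] at h1 h2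
  simp only [Finsupp.add_apply, Finsupp.smul_apply, smul_eq_mul, Nat.cast_add, Nat.cast_mul,
      dg_cast, map_add, Pi.add_apply]
  rw [h1, ← h2]
  ring

end PartH
section PartN
variable {V : Type*} [Fintype V]

theorem bd_single (R : Type*) [CommRing R] (G : SimpleGraph V) (e : G.edgeSet) (v : V) :
    bd R G (Pi.single e 1) v = if v ∈ (e : Sym2 V) then 1 else 0 := by
  rw [bd_apply, Finset.sum_eq_single e]
  · simp
  · intro b _ hb
    simp [Pi.single_eq_of_ne hb]
  · simp

theorem bd_edge (R : Type*) [CommRing R] (G : SimpleGraph V) {a b : V} (h : G.Adj a b) :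
    bd R G (Pi.single ⟨s(a, b), h⟩ 1) = Pi.single a 1 + Pi.single b 1 := by
  ext v
  rw [bd_single]
  have hab : a ≠ b := h.ne
  simp only [Sym2.mem_iff, Pi.add_apply, Pi.single_apply]
  by_cases h1 : v = a
  · subst h1; simp [hab]
  · simp [h1]

/-- the alternating vector of a walk -/
def alt (R : Type*) [CommRing R] {G : SimpleGraph V} : {a b : V} → G.Walk a b → (G.edgeSet → R)
  | _, _, .nil => 0
  | _, _, .cons h p => Pi.single ⟨s(_, _), h⟩ 1 - alt R p

theorem bd_alt (R : Type*) [CommRing R] {G : SimpleGraph V} {a b : V} (p : G.Walk a b) :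
    bd R G (alt R p) = Pi.single a 1 - ((-1 : R) ^ p.length) • Pi.single b 1 := by
  induction p with
  | nil => simp [alt]
  | cons h p ih =>
    rw [alt, map_sub, ih, bd_edge, SimpleGraph.Walk.length_cons, pow_succ, mul_neg_one, neg_smul]
    abel

theorem alt_of_notMem (R : Type*) [CommRing R] {G : SimpleGraph V} {a b : V} (p : G.Walk a b)
    (e : G.edgeSet) (he : (e : Sym2 V) ∉ p.edges) : alt R p e = 0 := by
  induction p with
  | nil => simp [alt]
  | cons h p ih =>
    rw [SimpleGraph.Walk.edges_cons, List.mem_cons, not_or] at he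
    rw [alt, Pi.sub_apply, ih he.2, Pi.single_eq_of_ne, sub_zero]
    intro h'
    exact he.1 (congrArg Subtype.val h')

theorem alt_of_mem (R : Type*) [CommRing R] {G : SimpleGraph V} {a b : V} (p : G.Walk a b)
    (hp : p.IsTrail) (e : G.edgeSet) (he : (e : Sym2 V) ∈ p.edges) :
    alt R p e = 1 ∨ alt R p e = -1 := by
  induction p with
  | nil => simp at he
  | @cons u v w h p ih =>
    rw [SimpleGraph.Walk.isTrail_cons] at hp
    rw [alt, Pi.sub_apply]
    by_cases h1 : (e : Sym2 V) = s(u, v)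
    · have h2 : e = ⟨s(u, v), h⟩ := Subtype.ext h1
      subst h2
      left
      rw [alt_of_notMem R p _ hp.2]
      simp
    · rw [Pi.single_eq_of_ne (fun h' => h1 (congrArg Subtype.val h'))]
      have : (e : Sym2 V) ∈ p.edges := by
        simpa [h1] using he
      rcases ih hp.1 this with h3 | h3 <;> simp [h3]

theorem card_mem_edge (G : SimpleGraph V) (e : G.edgeSet) :
    (Finset.univ.filter (fun v => v ∈ (e : Sym2 V))).card = 2 := by
  obtain ⟨e, he⟩ := e
  induction e with
  | h a b =>
    have hab : a ≠ b := G.ne_of_adj he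
    have : Finset.univ.filter (fun v => v ∈ s(a, b)) = {a, b} := by
      ext v; simp
    simp only [this]
    exact Finset.card_pair hab

theorem sum_bd (R : Type*) [CommRing R] (G : SimpleGraph V) (z : G.edgeSet → R) :
    ∑ v, bd R G z v = 2 * ∑ e, z e := by
  simp only [bd_apply]
  rw [Finset.sum_comm, Finset.mul_sum]
  refine Finset.sum_congr rfl fun e _ => ?_
  rw [← Finset.mul_sum, Finset.sum_boole, card_mem_edge, mul_comm]
  simp

/-- the non-integral coordinates -/
def Fr {G : SimpleGraph V} (y : G.edgeSet → ℚ) : Finset G.edgeSet :=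
  Finset.univ.filter fun e => Int.fract (y e) ≠ 0

theorem mem_Fr {G : SimpleGraph V} (y : G.edgeSet → ℚ) (e) : e ∈ Fr y ↔ Int.fract (y e) ≠ 0 := by
  simp [Fr]

theorem shift {G : SimpleGraph V} (y z : G.edgeSet → ℚ) (hy : ∀ e, 0 ≤ y e) (hz : z ≠ 0)
    (hsupp : ∀ e, e ∉ Fr y → z e = 0) :
    ∃ t : ℚ, (∀ e, 0 ≤ (y + t • z) e) ∧ (Fr (y + t • z)).card < (Fr y).card := by
  let te : G.edgeSet → ℚ := fun e =>
    if 0 < z e then (⌊y e⌋ + 1 - y e) / z e else (y e - ⌊y e⌋) / (- z e)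
  let s := Finset.univ.filter fun e => z e ≠ 0
  have hs : s.Nonempty := by
    obtain ⟨e, he⟩ := Function.ne_iff.1 hz
    exact ⟨e, by simpa [s] using he⟩
  obtain ⟨e0, he0, hmin⟩ := Finset.exists_min_image s te hs
  have hz0 : z e0 ≠ 0 := by simpa [s] using he0
  have hpos : ∀ e, 0 ≤ te e := by
    intro e
    simp only [te]
    have h1 := Int.floor_le (y e)
    have h2 := (Int.lt_floor_add_one (y e)).le
    split_ifs with h
    · exact div_nonneg (by linarith) h.le
    · exact div_nonneg (by linarith) (by linarith)
  have hbd : ∀ e, (⌊y e⌋ : ℚ) ≤ y e + te e0 * z e := by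
    intro e
    have h1 := Int.floor_le (y e)
    rcases lt_trichotomy (z e) 0 with h | h | h
    · have := hmin e (by simp [s, h.ne])
      have h3 : te e = (y e - ⌊y e⌋) / (- z e) := by simp [te, h.not_gt]
      rw [h3, le_div_iff₀ (by linarith)] at this
      linarith
    · rw [h]; simpa using h1
    · have := mul_nonneg (hpos e0) h.le
      linarith
  refine ⟨te e0, ?_, ?_⟩
  · intro e
    have h0 : (0 : ℚ) ≤ ⌊y e⌋ := by exact_mod_cast Int.floor_nonneg.2 (hy e)
    have := hbd e
    simp only [Pi.add_apply, Pi.smul_apply, smul_eq_mul]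
    linarith
  · refine Finset.card_lt_card ⟨?_, ?_⟩
    · intro e he
      by_contra hne
      rw [mem_Fr] at he
      simp only [Pi.add_apply, Pi.smul_apply, smul_eq_mul, hsupp e hne, mul_zero, add_zero] at he
      exact hne ((mem_Fr y e).2 he)
    · intro hsub
      have h1 : e0 ∈ Fr y := by
        by_contra hne
        exact hz0 (hsupp e0 hne)
      have h2 := (mem_Fr _ _).1 (hsub h1)
      apply h2
      simp only [Pi.add_apply, Pi.smul_apply, smul_eq_mul, te]
      split_ifs with h
      · rw [div_mul_cancel₀ _ hz0]
        have : y e0 + (⌊y e0⌋ + 1 - y e0) = ((⌊y e0⌋ + 1 : ℤ) : ℚ) := by push_cast; ring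
        rw [this, Int.fract_intCast]
      · rw [div_neg, neg_mul, div_mul_cancel₀ _ hz0]
        have : y e0 + -(y e0 - ⌊y e0⌋) = ((⌊y e0⌋ : ℤ) : ℚ) := by ring
        rw [this, Int.fract_intCast]

end PartN
set_option linter.unusedSectionVars false
section PartN2
variable {V : Type*} [Fintype V]

/-- edges of a set incident to a vertex -/
def inc {G : SimpleGraph V} (F : Finset G.edgeSet) (v : V) : Finset G.edgeSet :=
  F.filter fun e : G.edgeSet => v ∈ (e : Sym2 V)

theorem mem_inc {G : SimpleGraph V} {F : Finset G.edgeSet} {v : V} {e : G.edgeSet} :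
    e ∈ inc F v ↔ e ∈ F ∧ v ∈ (e : Sym2 V) := by simp [inc]

theorem bd_supp (R : Type*) [CommRing R] (G : SimpleGraph V) (F : Finset G.edgeSet)
    (z : G.edgeSet → R) (hz : ∀ e, e ∉ F → z e = 0) (v : V) :
    bd R G z v = ∑ e ∈ inc F v, z e := by
  rw [bd_apply, inc, Finset.sum_filter]
  rw [← Finset.sum_subset (Finset.subset_univ F)]
  · simp
  · intro e _ he
    simp [hz e he]

theorem fract_sum_int {G : SimpleGraph V} (y : G.edgeSet → ℚ) (v : V)
    (hint : ∃ m : ℤ, bd ℚ G y v = m) :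
    ∃ m : ℤ, ∑ e ∈ inc (Fr y) v, Int.fract (y e) = m := by
  obtain ⟨m, hm⟩ := hint
  refine ⟨m - ∑ e : G.edgeSet, ⌊y e⌋ * if v ∈ (e : Sym2 V) then 1 else 0, ?_⟩
  rw [← bd_supp ℚ G (Fr y) (fun e => Int.fract (y e))]
  · push_cast
    rw [← hm, bd_apply, bd_apply, ← Finset.sum_sub_distrib]
    refine Finset.sum_congr rfl fun e _ => ?_
    rw [← Int.self_sub_floor]
    ring
  · intro e he
    rw [mem_Fr] at he
    simpa using he

theorem sum_dF (G : SimpleGraph V) (F : Finset G.edgeSet) :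
    ∑ v, (inc F v).card = 2 * F.card := by
  simp only [inc, Finset.card_filter]
  rw [Finset.sum_comm]
  rw [Finset.sum_congr rfl (g := fun _ => 2)]
  · simp [mul_comm]
  · intro e _
    rw [← Finset.card_filter, card_mem_edge]

theorem card_F_le (G : SimpleGraph V) (F : Finset G.edgeSet)
    (hker : ∀ z : G.edgeSet → ℚ, bd ℚ G z = 0 → (∀ e, e ∉ F → z e = 0) → z = 0) :
    F.card ≤ (Finset.univ.filter
      fun v => (inc F v).Nonempty).card := by
  set VF := Finset.univ.filter
      fun v => (inc F v).Nonempty with hVF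
  let ext : (F → ℚ) →ₗ[ℚ] (G.edgeSet → ℚ) := Function.ExtendByZero.linearMap ℚ Subtype.val
  let L : (F → ℚ) →ₗ[ℚ] (VF → ℚ) :=
    (LinearMap.funLeft ℚ ℚ (Subtype.val : VF → V)) ∘ₗ (bd ℚ G) ∘ₗ ext
  have hext0 : ∀ z e, e ∉ F → ext z e = 0 := by
    intro z e he
    simp only [ext, Function.ExtendByZero.linearMap_apply]
    rw [Function.extend_apply']
    · rfl
    · rintro ⟨a, rfl⟩; exact he a.2
  have hL : Function.Injective L := by
    rw [injective_iff_map_eq_zero]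
    intro z hz
    have h1 : bd ℚ G (ext z) = 0 := by
      ext v
      by_cases hv : v ∈ VF
      · exact congrFun hz ⟨v, hv⟩
      · rw [bd_supp ℚ G F _ (hext0 z)]
        have : inc F v = ∅ := by
          simpa [hVF, Finset.not_nonempty_iff_eq_empty] using hv
        rw [this]; simp
    have h2 := hker _ h1 (hext0 z)
    ext f
    have := congrFun h2 f.1
    simp only [ext, Function.ExtendByZero.linearMap_apply] at this
    rwa [Subtype.val_injective.extend_apply] at this
  have := LinearMap.finrank_le_finrank_of_injective hL
  simpa using this

theorem struct {G : SimpleGraph V} (y : G.edgeSet → ℚ) (hint : ∀ v, ∃ m : ℤ, bd ℚ G y v = m)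
    (hker : ∀ z : G.edgeSet → ℚ, bd ℚ G z = 0 → (∀ e, e ∉ Fr y → z e = 0) → z = 0) :
    (∀ v, (inc (Fr y) v).Nonempty →
      (inc (Fr y) v).card = 2) ∧
    (∀ e ∈ Fr y, Int.fract (y e) = 1 / 2) ∧
    (Fr y).card = (Finset.univ.filter
      fun v => (inc (Fr y) v).Nonempty).card := by
  set F := Fr y with hF
  set VF := Finset.univ.filter
      fun v => (inc F v).Nonempty with hVF
  have hle : F.card ≤ VF.card := card_F_le G F hker
  have hpos : ∀ e ∈ F, 0 < Int.fract (y e) := fun e he =>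
    lt_of_le_of_ne (Int.fract_nonneg _) (Ne.symm ((mem_Fr y e).1 he))
  have h2 : ∀ v ∈ VF, 2 ≤ (inc F v).card := by
    intro v hv
    have hne : (inc F v).Nonempty := by simpa [hVF] using hv
    by_contra hlt
    have h1 : (inc F v).card = 1 := by
      have := hne.card_pos; omega
    obtain ⟨e, he⟩ := Finset.card_eq_one.1 h1
    obtain ⟨m, hm⟩ := fract_sum_int y v (hint v)
    rw [← hF, he, Finset.sum_singleton] at hm
    have heF : e ∈ F := (mem_inc.1 (he ▸ Finset.mem_singleton_self e :
      e ∈ inc F v)).1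
    have a1 := hpos e heF
    have a2 := Int.fract_lt_one (y e)
    rw [hm] at a1 a2
    have : 0 < m := by exact_mod_cast a1
    have : m < 1 := by exact_mod_cast a2
    omega
  have hsum : ∑ v ∈ VF, (inc F v).card = 2 * F.card := by
    rw [← sum_dF]
    refine Finset.sum_subset (Finset.subset_univ _) fun v _ hv => ?_
    have : inc F v = ∅ := by
      simpa [hVF, Finset.not_nonempty_iff_eq_empty] using hv
    rw [this]; rfl
  have hsum2 : ∑ v ∈ VF, 2 ≤ ∑ v ∈ VF, (inc F v).card :=
    Finset.sum_le_sum h2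
  have hsum3 : ∑ v ∈ VF, 2 = ∑ v ∈ VF, (inc F v).card := by
    rw [hsum] at hsum2 ⊢
    simp only [Finset.sum_const, smul_eq_mul] at hsum2 ⊢
    omega
  have heq := (Finset.sum_eq_sum_iff_of_le h2).1 hsum3
  have hd : ∀ v, (inc F v).Nonempty →
      (inc F v).card = 2 := by
    intro v hv
    exact (heq v (by simpa [hVF] using hv)).symm
  refine ⟨hd, ?_, ?_⟩
  · have hz : (fun e => if e ∈ F then Int.fract (y e) - 1 / 2 else 0) = (0 : G.edgeSet → ℚ) := by
      apply hker
      · ext v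
        rw [bd_supp ℚ G F _ (fun e he => by simp [he])]
        rw [Finset.sum_congr rfl (g := fun e => Int.fract (y e) - 1 / 2)
          (fun e he => by simp [(mem_inc.1 he).1])]
        rw [Finset.sum_sub_distrib]
        by_cases hv : (inc F v).Nonempty
        · obtain ⟨m, hm⟩ := fract_sum_int y v (hint v)
          have b1 : 0 < ∑ e ∈ inc F v, Int.fract (y e) :=
            Finset.sum_pos (fun e he => hpos e (mem_inc.1 he).1) hv
          have b2 : ∑ e ∈ inc F v, Int.fract (y e) <
              ∑ e ∈ inc F v, 1 :=
            Finset.sum_lt_sum_of_nonempty hv (fun e _ => Int.fract_lt_one _)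
          rw [← hF] at hm
          rw [hm] at b1 b2 ⊢
          rw [Finset.sum_const, hd v hv] at b2 ⊢
          have c1 : 0 < m := by exact_mod_cast b1
          have c2 : m < 2 := by
            have : (m : ℚ) < 2 := by simpa using b2
            exact_mod_cast this
          have : m = 1 := by omega
          subst this; norm_num
        · rw [Finset.not_nonempty_iff_eq_empty] at hv
          rw [hv]; simp
      · intro e he; simp [he]
    intro e he
    have := congrFun hz e
    simp only [he, if_true, Pi.zero_apply] at this
    linarith
  · rw [hsum] at hsum3
    simp only [Finset.sum_const, smul_eq_mul] at hsum3
    omega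

end PartN2
section PartN3
variable {V : Type*} [Fintype V]

/-- the subgraph with a given edge set -/
def GF {G : SimpleGraph V} (F : Finset G.edgeSet) : SimpleGraph V where
  Adj a b := ∃ h : G.Adj a b, (⟨s(a, b), h⟩ : G.edgeSet) ∈ F
  symm := ⟨by
    rintro a b ⟨h, hF⟩
    refine ⟨h.symm, ?_⟩
    have : (⟨s(b, a), h.symm⟩ : G.edgeSet) = ⟨s(a, b), h⟩ := Subtype.ext Sym2.eq_swap
    rwa [this]⟩
  loopless := ⟨fun a h => G.loopless.irrefl a h.1⟩

theorem GF_le {G : SimpleGraph V} (F : Finset G.edgeSet) : GF F ≤ G := fun _ _ h => h.1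

theorem GF_mem {G : SimpleGraph V} {F : Finset G.edgeSet} (e : G.edgeSet)
    (he : (e : Sym2 V) ∈ (GF F).edgeSet) : e ∈ F := by
  obtain ⟨e, h⟩ := e
  induction e with
  | h a b => exact he.2

theorem GF_ncard {G : SimpleGraph V} (F : Finset G.edgeSet) (v : V) :
    ((GF F).neighborSet v).ncard = (inc F v).card := by
  rw [← Set.ncard_coe_finset]
  refine Set.ncard_congr (fun w (hw : (GF F).Adj v w) => (⟨s(v, w), hw.1⟩ : G.edgeSet)) ?_ ?_ ?_
  · intro w hw
    exact mem_inc.2 ⟨hw.2, by simp⟩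
  · intro a b ha hb hab
    have := congrArg Subtype.val hab
    exact Sym2.congr_right.1 this
  · rintro ⟨e, he⟩ hb
    have hb' := mem_inc.1 hb
    obtain ⟨w, hw⟩ := Sym2.mem_iff_exists.1 hb'.2
    simp only at hw
    subst hw
    exact ⟨w, ⟨he, hb'.1⟩, rfl⟩

theorem cyc {G : SimpleGraph V} (F : Finset G.edgeSet)
    (hd : ∀ v, (inc F v).Nonempty → (inc F v).card = 2) (v : V) (hv : (inc F v).Nonempty) :
    ∃ q : G.Walk v v, q.IsCycle ∧ (∀ e : G.edgeSet, (e : Sym2 V) ∈ q.edges → e ∈ F) ∧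
      (∀ w, w ∈ q.support ↔ (GF F).Reachable v w) := by
  have hne : ∀ v, ((GF F).neighborSet v).Nonempty → (inc F v).Nonempty := by
    intro v hv
    rw [← Finset.card_pos, ← GF_ncard]
    exact (Set.ncard_pos).2 hv
  have hc : (GF F).IsCycles := by
    intro v hv
    rw [GF_ncard]
    exact hd v (hne v hv)
  have hn : ((GF F).neighborSet v).Nonempty := by
    rw [← Set.ncard_pos, GF_ncard]
    exact hv.card_pos
  obtain ⟨p, hp, hps⟩ := hc.exists_cycle_toSubgraph_verts_eq_connectedComponentSupp
    (c := (GF F).connectedComponentMk v) (v := v) rfl hn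
  refine ⟨p.mapLe (GF_le F), hp.mapLe _, ?_, ?_⟩
  · intro e he
    rw [SimpleGraph.Walk.edges_mapLe_eq_edges] at he
    exact GF_mem e (p.edges_subset_edgeSet he)
  · intro w
    rw [SimpleGraph.Walk.support_mapLe_eq_support, ← SimpleGraph.Walk.mem_verts_toSubgraph, hps,
      SimpleGraph.ConnectedComponent.mem_supp_iff, SimpleGraph.ConnectedComponent.eq]
    exact ⟨fun h => h.symm, fun h => h.symm⟩

theorem cyc_odd {G : SimpleGraph V} (F : Finset G.edgeSet)
    (hker : ∀ z : G.edgeSet → ℚ, bd ℚ G z = 0 → (∀ e, e ∉ F → z e = 0) → z = 0)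
    {v : V} (q : G.Walk v v) (hq : q.IsCycle)
    (hF : ∀ e : G.edgeSet, (e : Sym2 V) ∈ q.edges → e ∈ F) : Odd q.length := by
  by_contra hodd
  rw [Nat.not_odd_iff_even] at hodd
  have h0 := hker (alt ℚ q) (by rw [bd_alt, hodd.neg_one_pow]; simp)
    (fun e he => alt_of_notMem ℚ q e fun h => he (hF e h))
  obtain ⟨e, he⟩ : ∃ e, e ∈ q.edges := by
    apply List.exists_mem_of_length_pos
    rw [SimpleGraph.Walk.length_edges]
    have := hq.three_le_length
    omega
  have := alt_of_mem ℚ q hq.isTrail ⟨e, q.edges_subset_edgeSet he⟩ he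
  rw [h0] at this
  norm_num at this

theorem cyc_inc {G : SimpleGraph V} (F : Finset G.edgeSet)
    {v : V} (q : G.Walk v v) (hq : q.IsCycle)
    (hF : ∀ e : G.edgeSet, (e : Sym2 V) ∈ q.edges → e ∈ F) (w : V) (hw : w ∈ q.support) :
    (inc F w).Nonempty := by
  rw [SimpleGraph.Walk.mem_support_iff_exists_mem_edges_of_not_nil hq.not_nil] at hw
  obtain ⟨e, he, hwe⟩ := hw
  exact ⟨⟨e, q.edges_subset_edgeSet he⟩, mem_inc.2 ⟨hF _ he, hwe⟩⟩

theorem cyc_card {G : SimpleGraph V} {v : V} (q : G.Walk v v) (hq : q.IsCycle) :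
    q.support.toFinset.card = q.length := by
  have h1 : q.support.toFinset = q.support.tail.toFinset := by
    ext w
    simp only [List.mem_toFinset]
    constructor
    · intro h
      rw [SimpleGraph.Walk.mem_support_iff] at h
      rcases h with rfl | h
      · exact SimpleGraph.Walk.end_mem_tail_support hq.not_nil
      · exact h
    · exact List.mem_of_mem_tail
  rw [h1, List.toFinset_card_of_nodup hq.support_nodup, List.length_tail,
    SimpleGraph.Walk.length_support]
  simp

theorem two_cycles {G : SimpleGraph V} (hocc : OddCycleCondition G) (F : Finset G.edgeSet)
    (hne : F.Nonempty)
    (hd : ∀ v, (inc F v).Nonempty → (inc F v).card = 2)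
    (hker : ∀ z : G.edgeSet → ℚ, bd ℚ G z = 0 → (∀ e, e ∉ F → z e = 0) → z = 0)
    (hev : Even (Finset.univ.filter fun v => (inc F v).Nonempty).card) :
    ∃ (a b : V) (p : G.Walk a a) (q : G.Walk b b), p.IsCycle ∧ q.IsCycle ∧ Odd p.length ∧
      Odd q.length ∧ (∀ e : G.edgeSet, (e : Sym2 V) ∈ p.edges → e ∈ F) ∧
      (∀ e : G.edgeSet, (e : Sym2 V) ∈ q.edges → e ∈ F) ∧
      (∀ x, x ∈ p.support → x ∉ q.support) ∧ G.Adj a b := by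
  obtain ⟨e, he⟩ := hne
  have hv : (inc F (e : Sym2 V).out.1).Nonempty := ⟨e, mem_inc.2 ⟨he, Sym2.out_fst_mem _⟩⟩
  generalize (e : Sym2 V).out.1 = v at hv
  obtain ⟨p, hp, hpF, hps⟩ := cyc F hd v hv
  have hpo := cyc_odd F hker p hp hpF
  obtain ⟨w, hw, hvw⟩ : ∃ w, (inc F w).Nonempty ∧ ¬ (GF F).Reachable v w := by
    by_contra! hcon
    have : (Finset.univ.filter fun v => (inc F v).Nonempty) = p.support.toFinset := by
      ext w
      simp only [Finset.mem_filter, Finset.mem_univ, true_and, List.mem_toFinset]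
      exact ⟨fun h => (hps w).2 (hcon w h), cyc_inc F p hp hpF w⟩
    rw [this, cyc_card p hp] at hev
    exact (Nat.not_even_iff_odd.2 hpo) hev
  obtain ⟨q, hq, hqF, hqs⟩ := cyc F hd w hw
  have hqo := cyc_odd F hker q hq hqF
  obtain ⟨a, ha, b, hb, hab⟩ := hocc v w p q hp hq hpo hqo (by
    intro x hx hx'
    exact hvw (((hps x).1 hx).trans ((hqs x).1 hx').symm))
  obtain ⟨p', hp', hpF', hps'⟩ := cyc F hd a (cyc_inc F p hp hpF a ha)
  obtain ⟨q', hq', hqF', hqs'⟩ := cyc F hd b (cyc_inc F q hq hqF b hb)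
  refine ⟨a, b, p', q', hp', hq', cyc_odd F hker p' hp' hpF', cyc_odd F hker q' hq' hqF',
    hpF', hqF', ?_, hab⟩
  intro x hx hx'
  exact hvw ((((hps a).1 ha).trans ((hps' x).1 hx)).trans
    (((hqs b).1 hb).trans ((hqs' x).1 hx')).symm)

theorem no_frac {G : SimpleGraph V} (hocc : OddCycleCondition G) (y : G.edgeSet → ℚ)
    (hy : ∀ e, 0 ≤ y e) (x : G.edgeSet → ℤ) (hx : ∀ v, bd ℚ G y v = (bd ℤ G x v : ℤ))
    (hmin : ∀ y' : G.edgeSet → ℚ, (∀ e, 0 ≤ y' e) → bd ℚ G y' = bd ℚ G y →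
      (Fr y).card ≤ (Fr y').card) : Fr y = ∅ := by
  by_contra hne
  have hne' : (Fr y).Nonempty := Finset.nonempty_iff_ne_empty.2 hne
  have hker : ∀ z : G.edgeSet → ℚ, bd ℚ G z = 0 → (∀ e, e ∉ Fr y → z e = 0) → z = 0 := by
    intro z hz hs
    by_contra hz0
    obtain ⟨t, h1, h2⟩ := shift y z hy hz0 hs
    have := hmin _ h1 (by rw [map_add, map_smul, hz]; simp)
    omega
  obtain ⟨hd, hhalf, hcard⟩ := struct y (fun v => ⟨_, hx v⟩) hker
  have hfl : ∀ e ∈ Fr y, y e = ⌊y e⌋ + 1 / 2 := by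
    intro e he
    have := hhalf e he
    have h2 := Int.floor_add_fract (y e)
    linarith
  have hfl0 : ∀ e, e ∉ Fr y → y e = ⌊y e⌋ := by
    intro e he
    rw [mem_Fr, not_not] at he
    have h2 := Int.floor_add_fract (y e)
    linarith
  have hev : Even (Fr y).card := by
    have h1 : ∑ e, y e = ((∑ e, x e : ℤ) : ℚ) := by
      have a1 := sum_bd ℚ G y
      have a2 := sum_bd ℤ G x
      have a3 : ∑ v, bd ℚ G y v = ((∑ v, bd ℤ G x v : ℤ) : ℚ) := by
        rw [Int.cast_sum]; exact Finset.sum_congr rfl fun v _ => hx v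
      rw [a1, a2] at a3
      push_cast at a3 ⊢
      linarith
    have h2 : ∑ e, y e = ((∑ e, ⌊y e⌋ : ℤ) : ℚ) + (Fr y).card / 2 := by
      have : ∀ e, y e = (⌊y e⌋ : ℚ) + if e ∈ Fr y then 1 / 2 else 0 := by
        intro e
        split_ifs with h
        · exact hfl e h
        · simpa using hfl0 e h
      rw [Finset.sum_congr rfl fun e _ => this e, Finset.sum_add_distrib]
      push_cast
      congr 1
      rw [← Finset.sum_filter]
      simp
      ring
    rw [h1] at h2
    have h3 : (((Fr y).card : ℤ) : ℚ) = ((2 * (∑ e, x e - ∑ e, ⌊y e⌋) : ℤ) : ℚ) := by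
      push_cast at h2 ⊢
      linarith
    have h4 : ((Fr y).card : ℤ) = 2 * (∑ e, x e - ∑ e, ⌊y e⌋) := by exact_mod_cast h3
    have : Even ((Fr y).card : ℤ) := ⟨_, h4.trans (two_mul _)⟩
    exact_mod_cast this
  rw [hcard] at hev
  obtain ⟨a, b, p, q, hp, hq, hpo, hqo, hpF, hqF, hdis, hab⟩ :=
    two_cycles hocc (Fr y) hne' hd hker hev
  have hdis' : ∀ e : G.edgeSet, (e : Sym2 V) ∈ p.edges → (e : Sym2 V) ∉ q.edges := by
    rintro ⟨e, he⟩ h1 h2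
    induction e with
    | h u w =>
      exact hdis u (p.fst_mem_support_of_mem_edges h1) (q.fst_mem_support_of_mem_edges h2)
  set sg : G.edgeSet → ℚ := Pi.single ⟨s(a, b), hab⟩ 1 with hsg
  set y' : G.edgeSet → ℚ := y - (1 / 2 : ℚ) • alt ℚ p - (1 / 2 : ℚ) • alt ℚ q + sg with hy'
  have hsgv : ∀ e, sg e = 0 ∨ sg e = 1 := by
    intro e
    by_cases h : e = ⟨s(a, b), hab⟩
    · right; rw [hsg, h]; simp
    · left; rw [hsg, Pi.single_eq_of_ne h]
  have hbd : bd ℚ G y' = bd ℚ G y := by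
    rw [hy', map_add, map_sub, map_sub, map_smul, map_smul, bd_alt, bd_alt, hsg, bd_edge,
      hpo.neg_one_pow, hqo.neg_one_pow]
    ext v
    simp only [Pi.add_apply, Pi.sub_apply, Pi.smul_apply, smul_eq_mul]
    ring
  have hval : ∀ e, y' e = y e - 1 / 2 * alt ℚ p e - 1 / 2 * alt ℚ q e + sg e := by
    intro e; simp [hy']
  have hcase : ∀ e, (e ∉ Fr y ∧ y' e = y e + sg e) ∨ (e ∈ Fr y ∧ y' e = y e + sg e) ∨
      (e ∈ Fr y ∧ (y' e = y e - 1 / 2 + sg e ∨ y' e = y e + 1 / 2 + sg e)) := by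
    intro e
    rw [hval]
    by_cases h1 : (e : Sym2 V) ∈ p.edges
    · right; right
      rw [alt_of_notMem ℚ q e (hdis' e h1)]
      refine ⟨hpF e h1, ?_⟩
      rcases alt_of_mem ℚ p hp.isTrail e h1 with h | h <;> rw [h]
      · left; ring
      · right; ring
    · rw [alt_of_notMem ℚ p e h1]
      by_cases h2 : (e : Sym2 V) ∈ q.edges
      · right; right
        refine ⟨hqF e h2, ?_⟩
        rcases alt_of_mem ℚ q hq.isTrail e h2 with h | h <;> rw [h]
        · left; ring
        · right; ring
      · rw [alt_of_notMem ℚ q e h2]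
        by_cases h3 : e ∈ Fr y
        · right; left; exact ⟨h3, by ring⟩
        · left; exact ⟨h3, by ring⟩
  have hnn : ∀ e, 0 ≤ y' e := by
    intro e
    have h0 := hy e
    have hs : 0 ≤ sg e := by rcases hsgv e with h | h <;> rw [h] <;> norm_num
    rcases hcase e with ⟨_, h⟩ | ⟨_, h⟩ | ⟨hm, h | h⟩
    · linarith
    · linarith
    · have h1 := hfl e hm
      have : (0 : ℚ) ≤ ⌊y e⌋ := by exact_mod_cast Int.floor_nonneg.2 h0
      linarith
    · linarith
  have hlt : (Fr y').card < (Fr y).card := by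
    refine Finset.card_lt_card ⟨?_, ?_⟩
    · intro e he
      by_contra hne2
      rw [mem_Fr] at he
      apply he
      rcases hcase e with ⟨_, h⟩ | ⟨hm, _⟩ | ⟨hm, _⟩
      · rw [h, hfl0 e hne2]
        rcases hsgv e with h | h <;> rw [h]
        · simp
        · simp
      · exact absurd hm hne2
      · exact absurd hm hne2
    · intro hsub
      obtain ⟨e, he⟩ : ∃ e, e ∈ p.edges := by
        apply List.exists_mem_of_length_pos
        rw [SimpleGraph.Walk.length_edges]
        have := hp.three_le_length
        omega
      set e' : G.edgeSet := ⟨e, p.edges_subset_edgeSet he⟩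
      have h1 : (e' : Sym2 V) ∈ p.edges := he
      have h2 := (mem_Fr _ _).1 (hsub (hpF e' h1))
      apply h2
      have h3 := hfl e' (hpF e' h1)
      rw [hval, alt_of_notMem ℚ q e' (hdis' e' h1)]
      have key : ∃ n : ℤ, y e' - 1 / 2 * alt ℚ p e' - 1 / 2 * 0 + sg e' = n := by
        rcases alt_of_mem ℚ p hp.isTrail e' h1 with h | h <;> rcases hsgv e' with h4 | h4 <;>
          rw [h, h4]
        · exact ⟨⌊y e'⌋, by linarith⟩
        · exact ⟨⌊y e'⌋ + 1, by push_cast; linarith⟩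
        · exact ⟨⌊y e'⌋ + 1, by push_cast; linarith⟩
        · exact ⟨⌊y e'⌋ + 2, by push_cast; linarith⟩
      obtain ⟨n, hn⟩ := key
      rw [hn, Int.fract_intCast]
  have := hmin y' hnn hbd
  omega

theorem bd_cast {G : SimpleGraph V} (x : G.edgeSet → ℤ) (v : V) :
    bd ℚ G (fun e => (x e : ℚ)) v = (bd ℤ G x v : ℤ) := by
  simp [bd_apply]

theorem hnorm (G : SimpleGraph V) (hocc : OddCycleCondition G) (x : G.edgeSet → ℤ) (k : ℕ)
    (c : G.edgeSet →₀ ℕ) (hk : 0 < k) (h : (k : ℤ) • bd ℤ G x = bd ℤ G (expo c)) :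
    ∃ w : G.edgeSet →₀ ℕ, bd ℤ G x = bd ℤ G (expo w) := by
  let S : Set (G.edgeSet → ℚ) := {y | (∀ e, 0 ≤ y e) ∧ ∀ v, bd ℚ G y v = (bd ℤ G x v : ℤ)}
  have hk' : (k : ℚ) ≠ 0 := by exact_mod_cast hk.ne'
  have hS : S.Nonempty := by
    refine ⟨((k : ℚ)⁻¹) • (fun e => ((expo c e : ℤ) : ℚ)), ?_, ?_⟩
    · intro e
      simp only [Pi.smul_apply, smul_eq_mul, expo_apply]
      positivity
    · intro v
      rw [map_smul, Pi.smul_apply, bd_cast, ← h]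
      simp [hk']
  obtain ⟨y, hyS, hmin⟩ : ∃ y ∈ S, ∀ y' ∈ S, (Fr y).card ≤ (Fr y').card := by
    have := WellFounded.has_min (InvImage.wf (fun y : G.edgeSet → ℚ => (Fr y).card)
      Nat.lt_wfRel.wf) S hS
    obtain ⟨y, hy, hm⟩ := this
    exact ⟨y, hy, fun y' h' => not_lt.1 (hm y' h')⟩
  have h0 := no_frac hocc y hyS.1 x hyS.2 (fun y' h1 h2 => hmin y' ⟨h1, fun v => by
    rw [h2]; exact hyS.2 v⟩)
  refine ⟨Finsupp.equivFunOnFinite.symm fun e => ⌊y e⌋.toNat, ?_⟩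
  have h1 : ∀ e, y e = ((expo (Finsupp.equivFunOnFinite.symm fun e => ⌊y e⌋.toNat) e : ℤ) : ℚ) := by
    intro e
    have he : e ∉ Fr y := by simp [h0]
    rw [mem_Fr, not_not] at he
    have h2 := Int.floor_add_fract (y e)
    rw [expo_apply]
    simp only [Finsupp.equivFunOnFinite_symm_apply_apply]
    rw [Int.toNat_of_nonneg (Int.floor_nonneg.2 (hyS.1 e))]
    linarith
  ext v
  have h3 := hyS.2 v
  rw [show y = _ from funext h1, bd_cast] at h3
  exact_mod_cast h3.symm

end PartN3
section PartR
variable {V : Type*} [Fintype V]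

theorem fun_eq_sum (f : V → ℤ) : f = ∑ v, f v • Pi.single v (1 : ℤ) := by
  ext w
  rw [Finset.sum_apply, Finset.sum_eq_single w]
  · simp
  · intro b _ hb
    simp [Pi.single_eq_of_ne hb.symm]
  · simp

theorem rank_null {R : Type*} [CommRing R] [IsDomain R] {N M : Type*} [AddCommGroup N] [Module R N]
    [Module.Finite R N] [AddCommGroup M] [Module R M] (φ : N →ₗ[R] M) :
    Module.finrank R (LinearMap.range φ) + Module.finrank R (LinearMap.ker φ) =
      Module.finrank R N := by
  rw [← LinearEquiv.finrank_eq φ.quotKerEquivRange]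
  exact Submodule.finrank_quotient_add_finrank (LinearMap.ker φ)

theorem rank_nullity (G : SimpleGraph V) :
    Module.finrank ℤ (LinearMap.range (bd ℤ G)) + Module.finrank ℤ (LinearMap.ker (bd ℤ G)) =
      Nat.card G.edgeSet := by
  rw [rank_null, Module.finrank_fintype_fun_eq_card,
    Nat.card_eq_fintype_card]

theorem rank_nonbip (G : SimpleGraph V) (hconn : G.Connected) (h : ¬ G.Colorable 2) :
    Module.finrank ℤ (LinearMap.range (bd ℤ G)) = Fintype.card V := by
  rw [SimpleGraph.two_colorable_iff_forall_loop_even] at h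
  push Not at h
  obtain ⟨u, p, hp⟩ := h
  rw [Nat.not_even_iff_odd] at hp
  have h2 : ∀ v, (2 : ℤ) • Pi.single v (1 : ℤ) ∈ LinearMap.range (bd ℤ G) := by
    intro v
    obtain ⟨w⟩ := hconn.preconnected v u
    refine ⟨alt ℤ ((w.append p).append w.reverse), ?_⟩
    rw [bd_alt]
    have : Odd ((w.append p).append w.reverse).length := by
      simp only [SimpleGraph.Walk.length_append, SimpleGraph.Walk.length_reverse]
      obtain ⟨m, hm⟩ := hp
      exact ⟨w.length + m, by omega⟩
    rw [this.neg_one_pow, neg_one_smul, sub_neg_eq_add, two_smul]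
  apply le_antisymm
  · simpa using Submodule.finrank_le (LinearMap.range (bd ℤ G))
  · have h3 : ∀ f : V → ℤ, (2 : ℤ) • f ∈ LinearMap.range (bd ℤ G) := by
      intro f
      rw [fun_eq_sum f, Finset.smul_sum]
      refine Submodule.sum_mem _ fun v _ => ?_
      rw [smul_comm]
      exact Submodule.smul_mem _ _ (h2 v)
    let L : (V → ℤ) →ₗ[ℤ] LinearMap.range (bd ℤ G) :=
      LinearMap.codRestrict _ ((2 : ℤ) • LinearMap.id) h3
    have hL : Function.Injective L := by
      intro f g hfg
      have := congrArg Subtype.val hfg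
      have h4 : (2 : ℤ) • f = (2 : ℤ) • g := this
      ext v
      have := congrFun h4 v
      simpa using this
    simpa using LinearMap.finrank_le_finrank_of_injective hL

theorem rank_bip (G : SimpleGraph V) (hconn : G.Connected) (h : G.Colorable 2) :
    Module.finrank ℤ (LinearMap.range (bd ℤ G)) + 1 = Fintype.card V := by
  obtain ⟨col⟩ := h
  let sgn : V → ℤ := fun v => if col v = 0 then 1 else -1
  have hs : ∀ v, sgn v * sgn v = 1 := by
    intro v; simp only [sgn]; split_ifs <;> norm_num
  have hadj : ∀ a b, G.Adj a b → sgn a = - sgn b := by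
    intro a b hab
    have := col.valid hab
    simp only [sgn]
    generalize col a = i at *
    generalize col b = j at *
    fin_cases i <;> fin_cases j <;> simp_all
  have hwalk : ∀ a b (p : G.Walk a b), sgn a = (-1) ^ p.length * sgn b := by
    intro a b p
    induction p with
    | nil => simp
    | cons h p ih =>
      rw [hadj _ _ h, ih, SimpleGraph.Walk.length_cons, pow_succ]; ring
  obtain ⟨v0⟩ := hconn.nonempty
  let φ : (V → ℤ) →ₗ[ℤ] ℤ := ∑ v, sgn v • LinearMap.proj v
  have hφ : ∀ f, φ f = ∑ v, sgn v * f v := by intro f; simp [φ]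
  have hφs : ∀ v, φ (Pi.single v 1) = sgn v := by
    intro v
    rw [hφ, Finset.sum_eq_single v]
    · simp
    · intro b _ hb
      simp [Pi.single_eq_of_ne hb]
    · simp
  have hcomp : φ ∘ₗ bd ℤ G = 0 := by
    apply LinearMap.pi_ext
    rintro ⟨e, he⟩ c
    induction e with
    | h a b =>
      have : (Pi.single (⟨s(a, b), he⟩ : G.edgeSet) c : G.edgeSet → ℤ) =
          c • Pi.single (⟨s(a, b), he⟩ : G.edgeSet) 1 := by
        rw [← Pi.single_smul]; simp
      rw [this, map_smul, LinearMap.comp_apply, bd_edge ℤ G he, map_add, hφs, hφs, hadj a b he]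
      simp
  have hrange : LinearMap.range (bd ℤ G) = LinearMap.ker φ := by
    apply le_antisymm
    · rintro _ ⟨x, rfl⟩
      exact LinearMap.congr_fun hcomp x
    · intro f hf
      rw [LinearMap.mem_ker, hφ] at hf
      have h1 : ∀ v, Pi.single v (1 : ℤ) - (sgn v * sgn v0) • Pi.single v0 (1 : ℤ) ∈
          LinearMap.range (bd ℤ G) := by
        intro v
        obtain ⟨w⟩ := hconn.preconnected v v0
        refine ⟨alt ℤ w, ?_⟩
        rw [bd_alt, hwalk v v0 w, mul_assoc, hs, mul_one]
      have h2 : f = ∑ v, f v • (Pi.single v (1 : ℤ) - (sgn v * sgn v0) • Pi.single v0 (1 : ℤ)) := by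
        simp only [smul_sub, Finset.sum_sub_distrib, smul_smul]
        rw [← fun_eq_sum, ← Finset.sum_smul]
        have : ∑ v, f v * (sgn v * sgn v0) = (∑ v, sgn v * f v) * sgn v0 := by
          rw [Finset.sum_mul]
          exact Finset.sum_congr rfl fun v _ => by ring
        rw [this, hf]; simp
      rw [h2]
      exact Submodule.sum_mem _ fun v _ => Submodule.smul_mem _ _ (h1 v)
  have htop : LinearMap.range φ = ⊤ := by
    rw [LinearMap.range_eq_top]
    intro n
    refine ⟨(n * sgn v0) • Pi.single v0 1, ?_⟩
    rw [map_smul, hφs, smul_eq_mul, mul_assoc, hs, mul_one]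
  have := rank_null φ
  rw [htop, finrank_top, Module.finrank_self, Module.finrank_fintype_fun_eq_card] at this
  rw [hrange, add_comm, this]

end PartR
/-- Projective dimension of a normal edge ring. -/
theorem statement1 (K : Type*) [Field K] (V : Type*) [Fintype V] (G : SimpleGraph V)
    (hconn : G.Connected) (hocc : OddCycleCondition G) :
    projDim (MvPolynomial G.edgeSet K) (ModuleCat.of _ (edgeRing K G)) =
      if G.Colorable 2 then ((Nat.card G.edgeSet + 1 - Fintype.card V : ℕ) : ℕ∞)
      else ((Nat.card G.edgeSet - Fintype.card V : ℕ) : ℕ∞) := by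
  have hrk := rank_nullity G
  have hc := toric_regChain K G
  have hup := toric_upper K G (exists_q G (hnorm G hocc)) _ hc
  have hlow : ¬ HasProjectiveDimensionLT
      (ModuleCat.of (MvPolynomial G.edgeSet K) (edgeRing K G))
      (Module.finrank ℤ (LinearMap.ker (bd ℤ G))) := by
    have key : ∀ I : Ideal (MvPolynomial G.edgeSet K),
        I = latIdeal K (LinearMap.ker (bd ℤ G)) →
        RegChain (prodX K G.edgeSet) (Module.finrank ℤ (LinearMap.ker (bd ℤ G))) I →
        ¬ HasProjectiveDimensionLT
          (ModuleCat.of (MvPolynomial G.edgeSet K) (MvPolynomial G.edgeSet K ⧸ I))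
          (Module.finrank ℤ (LinearMap.ker (bd ℤ G))) := by
      rintro I rfl h
      exact lat_lower _ h
    exact key _ (toric_eq_lat K G) hc
  rw [projDim_eq_of _ _ hup hlow]
  split_ifs with hcol
  · have := rank_bip G hconn hcol
    congr 1
    omega
  · have := rank_nonbip G hconn hcol
    congr 1
    omega

end Paper
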